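/- arXiv:1509.05468 — 2 statements merged into one kernel-verified Lean document; each statement's English description precedes it below -/
import Mathlib

section
/- Let Q be a left Bol loop (a loop satisfying x·(y·(x·z)) = (x·(y·x))·z for all x,y,z) which is an AIM loop. Then every associator and every commutator of Q lies in the nucleus N(Q), and every associator lies in the commutant; that is, for all x,y,z,u,v in Q: [[x,y,z],u,v] = [u,[x,y,z],v] = [u,v,[x,y,z]] = 1, [[x,y],z,u] = [z,[x,y],u] = [z,u,[x,y]] = 1, and [[x,y,z],u] = 1. (Equivalently, Q/N(Q) is an abelian group and Q/Z(Q) is a group.) -/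
/-- A loop: a set with multiplication, left division, right division and identity. -/
structure LoopStr (Q : Type*) where
  mul : Q → Q → Q
  ld : Q → Q → Q
  rd : Q → Q → Q
  one : Q
  one_mul : ∀ x, mul one x = x
  mul_one : ∀ x, mul x one = x
  ld_mul : ∀ x y, ld x (mul x y) = y
  mul_ld : ∀ x y, mul x (ld x y) = y
  rd_mul : ∀ x y, rd (mul x y) y = x
  mul_rd : ∀ x y, mul (rd x y) y = x

namespace LoopStr

variable {Q : Type*}

/-- The associator `[x,y,z] = (x·(y·z)) \ ((x·y)·z)`. -/
def assoc (L : LoopStr Q) (x y z : Q) : Q :=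
  L.ld (L.mul x (L.mul y z)) (L.mul (L.mul x y) z)

/-- The commutator `[x,y] = (y·x) \ (x·y)`. -/
def comm (L : LoopStr Q) (x y : Q) : Q :=
  L.ld (L.mul y x) (L.mul x y)

/-- `T(u,x) = x \ (u·x)`. -/
def Tm (L : LoopStr Q) (u x : Q) : Q := L.ld x (L.mul u x)

/-- `L(u,x,y) = (y·x) \ (y·(x·u))`. -/
def Lm (L : LoopStr Q) (u x y : Q) : Q :=
  L.ld (L.mul y x) (L.mul y (L.mul x u))

/-- `R(u,x,y) = ((u·x)·y) / (x·y)`. -/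
def Rm (L : LoopStr Q) (u x y : Q) : Q :=
  L.rd (L.mul (L.mul u x) y) (L.mul x y)

/-- The six AIM identities: the inner mapping generators commute. -/
def IsAIM (L : LoopStr Q) : Prop :=
  (∀ u x y, L.Tm (L.Tm u x) y = L.Tm (L.Tm u y) x) ∧
  (∀ u x y z w, L.Lm (L.Lm u x y) z w = L.Lm (L.Lm u z w) x y) ∧
  (∀ u x y z w, L.Rm (L.Rm u x y) z w = L.Rm (L.Rm u z w) x y) ∧
  (∀ u x y z, L.Tm (L.Lm u x y) z = L.Lm (L.Tm u z) x y) ∧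
  (∀ u x y z, L.Tm (L.Rm u x y) z = L.Rm (L.Tm u z) x y) ∧
  (∀ u x y z w, L.Lm (L.Rm u x y) z w = L.Rm (L.Lm u z w) x y)

/-- Membership in the nucleus `N(Q)`. -/
def inNucleus (L : LoopStr Q) (a : Q) : Prop :=
  (∀ x y, L.mul (L.mul a x) y = L.mul a (L.mul x y)) ∧
  (∀ x y, L.mul (L.mul x a) y = L.mul x (L.mul a y)) ∧
  (∀ x y, L.mul (L.mul x y) a = L.mul x (L.mul y a))

/-- Membership in the center `Z(Q) = C(Q) ∩ N(Q)`. -/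
def inCenter (L : LoopStr Q) (a : Q) : Prop :=
  (∀ x, L.mul a x = L.mul x a) ∧ L.inNucleus a

end LoopStr

/-- A left Bol loop (with `x⁻¹ * y` as left division) whose inner mapping generators commute. -/
class AIMBol (Q : Type*) extends MulOneClass Q, Inv Q where
  rdiv : Q → Q → Q
  inv_mul_l : ∀ x y : Q, x⁻¹ * (x * y) = y
  mul_inv_l : ∀ x y : Q, x * (x⁻¹ * y) = y
  rdiv_mul : ∀ x y : Q, rdiv (x * y) y = x
  mul_rdiv : ∀ x y : Q, rdiv x y * y = x
  bol : ∀ x y z : Q, x * (y * (x * z)) = (x * (y * x)) * z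
  aim_TT : ∀ u x y : Q, y⁻¹ * ((x⁻¹ * (u * x)) * y) = x⁻¹ * ((y⁻¹ * (u * y)) * x)
  aim_LL : ∀ u x y z w : Q, (w * z)⁻¹ * (w * (z * ((y * x)⁻¹ * (y * (x * u))))) =
    (y * x)⁻¹ * (y * (x * ((w * z)⁻¹ * (w * (z * u)))))
  aim_RR : ∀ u x y z w : Q, rdiv (rdiv (u * x * y) (x * y) * z * w) (z * w) =
    rdiv (rdiv (u * z * w) (z * w) * x * y) (x * y)
  aim_TL : ∀ u x y z : Q, z⁻¹ * ((y * x)⁻¹ * (y * (x * u)) * z) =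
    (y * x)⁻¹ * (y * (x * (z⁻¹ * (u * z))))
  aim_TR : ∀ u x y z : Q, z⁻¹ * (rdiv (u * x * y) (x * y) * z) =
    rdiv (z⁻¹ * (u * z) * x * y) (x * y)
  aim_LR : ∀ u x y z w : Q, (w * z)⁻¹ * (w * (z * (rdiv (u * x * y) (x * y)))) =
    rdiv ((w * z)⁻¹ * (w * (z * u)) * x * y) (x * y)

namespace AIMBol

open Equiv

variable {Q : Type*} [AIMBol Q]

attribute [simp] inv_mul_l mul_inv_l rdiv_mul mul_rdiv

/-! ### Translations -/

/-- Left translation. -/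
def lt (x : Q) : Perm Q := ⟨fun y => x * y, fun y => x⁻¹ * y, inv_mul_l x, mul_inv_l x⟩

/-- Right translation. -/
def rt (x : Q) : Perm Q :=
  ⟨fun y => y * x, fun y => rdiv y x, fun y => rdiv_mul y x, fun y => mul_rdiv y x⟩

@[simp] theorem lt_apply (x y : Q) : lt x y = x * y := rfl

@[simp] theorem rt_apply (x y : Q) : rt x y = y * x := rfl

@[simp] theorem lt_inv_apply (x y : Q) : (lt x)⁻¹ y = x⁻¹ * y := rfl

@[simp] theorem rt_inv_apply (x y : Q) : (rt x)⁻¹ y = rdiv y x := rfl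

@[simp] theorem lt_symm_apply (x y : Q) : (lt x).symm y = x⁻¹ * y := rfl

@[simp] theorem rt_symm_apply (x y : Q) : (rt x).symm y = rdiv y x := rfl

theorem mul_left_inj {x y z : Q} : x * y = x * z ↔ y = z := (lt x).injective.eq_iff

theorem mul_right_inj {x y z : Q} : y * x = z * x ↔ y = z := (rt x).injective.eq_iff

theorem eq_inv_mul {x y z : Q} : y = x⁻¹ * z ↔ x * y = z :=
  ⟨fun h => by rw [h, mul_inv_l], fun h => by rw [← h, inv_mul_l]⟩

theorem inv_mul_eq {x y z : Q} : x⁻¹ * z = y ↔ z = x * y := by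
  rw [eq_comm, eq_inv_mul, eq_comm]

@[simp] theorem mul_inv_self' (x : Q) : x * x⁻¹ = 1 := by
  simpa using mul_inv_l x 1

@[simp] theorem inv_mul_self' (x : Q) : x⁻¹ * x = 1 := by
  simpa using inv_mul_l x 1

@[simp] theorem inv_one' : (1 : Q)⁻¹ = 1 := by
  simpa only [mul_one] using inv_mul_self' (1 : Q)

@[simp] theorem inv_inv' (x : Q) : (x⁻¹)⁻¹ = x := by
  rw [← mul_left_inj (x := x⁻¹)]; simp

theorem lt_inv (x : Q) : (lt x)⁻¹ = lt x⁻¹ := by ext y; rfl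

@[simp] theorem lt_one : lt (1 : Q) = 1 := by ext y; simp

@[simp] theorem rt_one : rt (1 : Q) = 1 := by ext y; simp

theorem lt_bol (x y : Q) : lt (x * (y * x)) = lt x * lt y * lt x := by
  ext z; simp [bol]

theorem lt_pow (x : Q) (n : ℕ) : lt ((lt x ^ n) 1) = lt x ^ n := by
  induction n using Nat.strong_induction_on with
  | _ n ih =>
    match n with
    | 0 => simp
    | 1 => simp
    | n + 2 =>
      have h := ih n (by omega)
      have e : (lt x ^ (n + 2)) 1 = x * ((lt x ^ n) 1 * x) := by
        have : (lt x ^ n) 1 * x = (lt x ^ n) x := by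
          conv_rhs => rw [← h]
          rfl
        rw [this, pow_succ', pow_succ]
        simp
      rw [e, lt_bol, h, pow_succ', pow_succ, mul_assoc]

theorem lt_zpow (x : Q) (n : ℤ) : lt ((lt x ^ n) 1) = lt x ^ n := by
  obtain ⟨m, rfl | rfl⟩ := n.eq_nat_or_neg
  · simpa using lt_pow x m
  · simpa [zpow_neg, ← inv_pow, lt_inv] using lt_pow x⁻¹ m

/-- Conjugation-type inner mapping `T_x`. -/
def ti (x : Q) : Perm Q := (lt x)⁻¹ * rt x

/-- The inner mapping `L(x,y) = L_{yx}⁻¹ L_y L_x`. -/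
def li (x y : Q) : Perm Q := (lt (y * x))⁻¹ * lt y * lt x

/-- The inner mapping `R(x,y) = R_{xy}⁻¹ R_y R_x`. -/
def ri (x y : Q) : Perm Q := (rt (x * y))⁻¹ * rt y * rt x

/-- The inner mapping `R_z⁻¹ L_x⁻¹ R_z L_x`. -/
def ki (x z : Q) : Perm Q := (rt z)⁻¹ * (lt x)⁻¹ * rt z * lt x

theorem ti_apply (x y : Q) : ti x y = x⁻¹ * (y * x) := rfl

theorem li_def (x y : Q) : li x y = (lt (y * x))⁻¹ * lt y * lt x := rfl

theorem li_apply (x y z : Q) : li x y z = (y * x)⁻¹ * (y * (x * z)) := rfl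

theorem ri_apply (x y z : Q) : ri x y z = rdiv (z * x * y) (x * y) := rfl

theorem ki_apply (x z y : Q) : ki x z y = rdiv (x⁻¹ * (x * y * z)) z := rfl

theorem mul_ti (x y : Q) : x * ti x y = y * x := by simp [ti_apply]

theorem mul_li (x y z : Q) : y * x * li x y z = y * (x * z) := by simp [li_apply]

theorem ri_mul (x y z : Q) : ri x y z * (x * y) = z * x * y := by simp [ri_apply]

theorem ki_mul (x z y : Q) : x * (ki x z y * z) = x * y * z := by simp [ki_apply]

variable (Q) in
/-- The group generated by the inner mapping generators. -/
def H : Subgroup (Perm Q) :=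
  Subgroup.closure {g | (∃ x, g = ti x) ∨ (∃ x y, g = li x y) ∨ ∃ x y, g = ri x y}

theorem ti_mem (x : Q) : ti x ∈ H Q := Subgroup.subset_closure (Or.inl ⟨x, rfl⟩)

theorem li_mem (x y : Q) : li x y ∈ H Q := Subgroup.subset_closure (Or.inr (Or.inl ⟨x, y, rfl⟩))

theorem ri_mem (x y : Q) : ri x y ∈ H Q := Subgroup.subset_closure (Or.inr (Or.inr ⟨x, y, rfl⟩))

theorem H_comm {g h : Perm Q} (hg : g ∈ H Q) (hh : h ∈ H Q) : g * h = h * g := by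
  have tt (x y : Q) : ti x * ti y = ti y * ti x := by
    ext u; exact aim_TT u y x
  have ll (x y z w : Q) : li x y * li z w = li z w * li x y := by
    ext u; exact aim_LL u z w x y
  have rr (x y z w : Q) : ri x y * ri z w = ri z w * ri x y := by
    ext u; exact aim_RR u z w x y
  have tl (x y z : Q) : ti z * li x y = li x y * ti z := by
    ext u; exact aim_TL u x y z
  have tr (x y z : Q) : ti z * ri x y = ri x y * ti z := by
    ext u; exact aim_TR u x y z
  have lr (x y z w : Q) : li z w * ri x y = ri x y * li z w := by
    ext u; exact aim_LR u x y z w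
  have key : ∀ a ∈ {g : Perm Q | (∃ x, g = ti x) ∨ (∃ x y, g = li x y) ∨ ∃ x y, g = ri x y},
      ∀ b ∈ {g : Perm Q | (∃ x, g = ti x) ∨ (∃ x y, g = li x y) ∨ ∃ x y, g = ri x y},
      a * b = b * a := by
    rintro a (⟨x, rfl⟩ | ⟨x, y, rfl⟩ | ⟨x, y, rfl⟩) b (⟨z, rfl⟩ | ⟨z, w, rfl⟩ | ⟨z, w, rfl⟩)
    · exact tt x z
    · exact tl z w x
    · exact tr z w x
    · exact (tl x y z).symm
    · exact ll x y z w
    · exact lr z w x y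
    · exact (tr x y z).symm
    · exact (lr x y z w).symm
    · exact rr x y z w
  have hc := Subgroup.closure_le_centralizer_centralizer
    {g : Perm Q | (∃ x, g = ti x) ∨ (∃ x y, g = li x y) ∨ ∃ x y, g = ri x y}
  have h1 : h ∈ Subgroup.centralizer
      {g : Perm Q | (∃ x, g = ti x) ∨ (∃ x y, g = li x y) ∨ ∃ x y, g = ri x y} := by
    refine (Subgroup.closure_le _).2 ?_ hh
    intro a ha
    exact Subgroup.mem_centralizer_iff.2 fun b hb => key b hb a ha
  exact (Subgroup.mem_centralizer_iff.1 (hc hg) h h1).symm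

theorem H_comm_apply {g h : Perm Q} (hg : g ∈ H Q) (hh : h ∈ H Q) (x : Q) :
    g (h x) = h (g x) := congrArg (fun k : Perm Q => k x) (H_comm hg hh)

@[simp] theorem ti_one (x : Q) : ti x 1 = 1 := by simp [ti_apply]
@[simp] theorem li_one (x y : Q) : li x y 1 = 1 := by simp [li_apply]
@[simp] theorem ri_one (x y : Q) : ri x y 1 = 1 := by
  rw [← mul_right_inj (x := x * y), ri_mul]; simp
@[simp] theorem ki_one (x y : Q) : ki x y 1 = 1 := by
  rw [← mul_right_inj (x := y), ← mul_left_inj (x := x), ki_mul]; simp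

theorem H_one {h : Perm Q} (hh : h ∈ H Q) : h 1 = 1 := by
  have : H Q ≤ MulAction.stabilizer (Perm Q) (1 : Q) := by
    refine (Subgroup.closure_le _).2 ?_
    rintro a (⟨x, rfl⟩ | ⟨x, y, rfl⟩ | ⟨x, y, rfl⟩)
    · exact ti_one x
    · exact li_one x y
    · exact ri_one x y
  exact this hh

variable (Q) in
/-- The multiplication group. -/
def G : Subgroup (Perm Q) where
  carrier := {g | ∀ x, (lt (g x))⁻¹ * g * lt x ∈ H Q}
  one_mem' := fun x => by simp
  mul_mem' := fun {a b} ha hb x => by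
    have := mul_mem (ha (b x)) (hb x)
    simpa [mul_assoc] using this
  inv_mem' := fun {a} ha x => by
    have := inv_mem (ha (a⁻¹ x))
    simpa [mul_assoc] using this

theorem lt_mem (x : Q) : lt x ∈ G Q := fun y => li_mem y x

theorem rt_eq (x : Q) : rt x = lt x * ti x := by simp [ti]

theorem rt_mem (y : Q) : rt y ∈ G Q := fun x => by
  have : (lt (rt y x))⁻¹ * rt y * lt x = ti (x * y) * ri x y * (ti x)⁻¹ := by
    simp [ti, ri, mul_assoc]
  rw [this]
  exact mul_mem (mul_mem (ti_mem _) (ri_mem _ _)) (inv_mem (ti_mem _))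

theorem mem_H {g : Perm Q} (hg : g ∈ G Q) (h1 : g 1 = 1) : g ∈ H Q := by
  have := hg 1
  simpa [h1] using this

theorem ti_memG (x : Q) : ti x ∈ G Q := mul_mem (inv_mem (lt_mem _)) (rt_mem _)
theorem li_memG (x y : Q) : li x y ∈ G Q :=
  mul_mem (mul_mem (inv_mem (lt_mem _)) (lt_mem _)) (lt_mem _)
theorem ri_memG (x y : Q) : ri x y ∈ G Q :=
  mul_mem (mul_mem (inv_mem (rt_mem _)) (rt_mem _)) (rt_mem _)
theorem ki_memG (x y : Q) : ki x y ∈ G Q :=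
  mul_mem (mul_mem (mul_mem (inv_mem (rt_mem _)) (inv_mem (lt_mem _))) (rt_mem _)) (lt_mem _)

theorem ki_mem (x y : Q) : ki x y ∈ H Q := mem_H (ki_memG x y) (ki_one x y)

theorem H_le_G : H Q ≤ G Q := by
  refine (Subgroup.closure_le _).2 ?_
  rintro a (⟨x, rfl⟩ | ⟨x, y, rfl⟩ | ⟨x, y, rfl⟩)
  · exact ti_memG x
  · exact li_memG x y
  · exact ri_memG x y

/-- Two elements of the multiplication group with a common fixed point commute. -/
theorem comm_of_fix {g h : Perm Q} (hg : g ∈ G Q) (hh : h ∈ G Q) (a : Q) (ga : g a = a)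
    (ha : h a = a) : g * h = h * g := by
  have h1 : (lt a)⁻¹ * g * lt a ∈ H Q := by simpa [ga] using hg a
  have h2 : (lt a)⁻¹ * h * lt a ∈ H Q := by simpa [ha] using hh a
  have := H_comm h1 h2
  have e : (lt a)⁻¹ * (g * h) * lt a = (lt a)⁻¹ * (h * g) * lt a := by
    simpa [mul_assoc] using this
  simpa using e

/-! ### Congruences -/

/-- The congruence attached to a subgroup of the multiplication group containing `H`. -/
def Cg (P : Subgroup (Perm Q)) (x y : Q) : Prop := (lt x)⁻¹ * lt y ∈ P

section Congruence

variable {P : Subgroup (Perm Q)}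

theorem Cg.refl (x : Q) : Cg P x x := by simp [Cg]

theorem Cg.symm {x y : Q} (h : Cg P x y) : Cg P y x := by
  simpa [Cg] using inv_mem h

theorem Cg.trans {x y z : Q} (h : Cg P x y) (h' : Cg P y z) : Cg P x z := by
  simpa [Cg, mul_assoc] using mul_mem h h'

theorem Cg.app (hP : H Q ≤ P) {g : Perm Q} (hg : g ∈ G Q) {x y : Q} (h : Cg P x y) :
    Cg P (g x) (g y) := by
  have := mul_mem (mul_mem (hP (hg x)) h) (inv_mem (hP (hg y)))
  simpa [Cg, mul_assoc] using this

theorem Cg.mul (hP : H Q ≤ P) {x y x' y' : Q} (h : Cg P x x') (h' : Cg P y y') :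
    Cg P (x * y) (x' * y') :=
  (h'.app hP (lt_mem x)).trans (h.app hP (rt_mem y'))

theorem Cg.mul_left (hP : H Q ≤ P) (a : Q) {x y : Q} (h : Cg P x y) : Cg P (a * x) (a * y) :=
  h.app hP (lt_mem a)

theorem Cg.mul_right (hP : H Q ≤ P) (a : Q) {x y : Q} (h : Cg P x y) : Cg P (x * a) (y * a) :=
  h.app hP (rt_mem a)

theorem Cg.of_mul_left (hP : H Q ≤ P) (a : Q) {x y : Q} (h : Cg P (a * x) (a * y)) :
    Cg P x y := by
  simpa using h.app hP (lt_mem a⁻¹)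

theorem Cg.of_mul_right (hP : H Q ≤ P) (a : Q) {x y : Q} (h : Cg P (x * a) (y * a)) :
    Cg P x y := by
  simpa using h.app hP (inv_mem (rt_mem a))

theorem Cg.inv (hP : H Q ≤ P) {x y : Q} (h : Cg P x y) : Cg P x⁻¹ y⁻¹ := by
  refine Cg.of_mul_left hP y ?_
  have := (h.mul_right hP x⁻¹).symm
  simpa using this

theorem cg_one {x : Q} : Cg P 1 x ↔ lt x ∈ P := by simp [Cg]

theorem cg_iff (hP : H Q ≤ P) {x y : Q} : Cg P x y ↔ lt (x⁻¹ * y) ∈ P := by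
  rw [← cg_one]
  constructor
  · intro h
    simpa using h.mul_left hP x⁻¹
  · intro h
    simpa using h.mul_left hP x

theorem lt_app_mem (hP : H Q ≤ P) (hG : P ≤ G Q) {p : Perm Q} (hp : p ∈ P) : lt (p 1) ∈ P := by
  have h1 : (lt (p 1))⁻¹ * p ∈ P := hP (by simpa using hG hp 1)
  have := mul_mem hp (inv_mem h1)
  simpa using this

theorem lt_app_mem' (hP : H Q ≤ P) {h : Perm Q} (hh : h ∈ H Q) {x : Q} (hx : lt x ∈ P) :
    lt (h x) ∈ P := by
  rw [← cg_one] at hx ⊢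
  simpa [H_one hh] using hx.app hP (H_le_G hh)

theorem lt_mul_mem (hP : H Q ≤ P) {x y : Q} (hx : lt x ∈ P) (hy : lt y ∈ P) :
    lt (x * y) ∈ P := by
  rw [← cg_one] at hx hy ⊢
  simpa using hx.mul hP hy

theorem lt_inv_mem {x : Q} (hx : lt x ∈ P) : lt x⁻¹ ∈ P := lt_inv x ▸ inv_mem hx

theorem rt_mem_of_lt_mem (hP : H Q ≤ P) {x : Q} (hx : lt x ∈ P) : rt x ∈ P := by
  rw [rt_eq]; exact mul_mem hx (hP (ti_mem x))

end Congruence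

/-! ### The normal subloop generated by one element -/

/-- The subgroup generated by `H` and one left translation. -/
def PA (x : Q) : Subgroup (Perm Q) := Subgroup.closure (H Q ∪ {lt x})

/-- The normal subloop generated by `x`. -/
def A (x : Q) : Set Q := {u | lt u ∈ PA x}

theorem mem_A {x u : Q} : u ∈ A x ↔ lt u ∈ PA x := Iff.rfl

theorem H_le_PA (x : Q) : H Q ≤ PA x := fun _ hh => Subgroup.subset_closure (Or.inl hh)

theorem A_self (x : Q) : x ∈ A x := Subgroup.subset_closure (Or.inr rfl)

theorem PA_le_G (x : Q) : PA x ≤ G Q := by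
  refine (Subgroup.closure_le _).2 ?_
  rintro a (ha | rfl)
  · exact H_le_G ha
  · exact lt_mem x

theorem PA_le {x u : Q} (hu : u ∈ A x) : PA u ≤ PA x := by
  refine (Subgroup.closure_le _).2 ?_
  rintro a (ha | rfl)
  · exact H_le_PA x ha
  · exact hu

theorem A_le {x u : Q} (hu : u ∈ A x) : A u ⊆ A x := fun _ h => PA_le hu h

theorem A_mul {x u v : Q} (hu : u ∈ A x) (hv : v ∈ A x) : u * v ∈ A x :=
  lt_mul_mem (H_le_PA x) hu hv

theorem A_inv {x u : Q} (hu : u ∈ A x) : u⁻¹ ∈ A x :=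
  lt_inv_mem (P := PA x) hu

theorem A_one (x : Q) : (1 : Q) ∈ A x := by simp [mem_A, one_mem]

theorem A_app {x u : Q} {h : Perm Q} (hh : h ∈ H Q) (hu : u ∈ A x) : h u ∈ A x :=
  lt_app_mem' (H_le_PA x) hh hu

theorem cg_A {x u : Q} (hu : u ∈ A x) : Cg (PA x) 1 u := cg_one.2 hu

/-- An inner mapping fixing all powers of `x` fixes `A x` pointwise. -/
theorem fix_A_of_fix_pow {x : Q} {v : Perm Q} (hv : v ∈ H Q)
    (h : ∀ n : ℤ, v ((lt x ^ n) 1) = (lt x ^ n) 1) {u : Q} (hu : u ∈ A x) : v u = u := by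
  have hm (m : ℤ) : lt x ^ (-m) * v * lt x ^ m ∈ H Q := by
    refine mem_H (mul_mem (mul_mem (zpow_mem (lt_mem x) _) (H_le_G hv))
      (zpow_mem (lt_mem x) _)) ?_
    simp [h m]
  have key : ∀ p ∈ PA x, ∀ m : ℤ, (lt x ^ (-m) * v * lt x ^ m) (p 1) = p 1 := by
    intro p hp
    induction hp using Subgroup.closure_induction_left with
    | one => intro m; exact H_one (hm m)
    | mul_left a ha y hy ih =>
      intro m
      rcases ha with ha | rfl
      · rw [Perm.mul_apply a y, H_comm_apply (hm m) ha, ih]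
      · have : lt x ^ (-m) * v * lt x ^ m * lt x =
            lt x * (lt x ^ (-(m + 1)) * v * lt x ^ (m + 1)) := by
          rw [zpow_add_one, neg_add, add_comm, zpow_add, zpow_neg_one]
          simp [mul_assoc]
        rw [Perm.mul_apply (lt x) y, ← Perm.mul_apply, this, Perm.mul_apply, ih]
    | inv_mul_cancel a ha y hy ih =>
      intro m
      rcases ha with ha | rfl
      · rw [Perm.mul_apply a⁻¹ y, H_comm_apply (hm m) (inv_mem ha), ih]
      · have : lt x ^ (-m) * v * lt x ^ m * (lt x)⁻¹ =
            (lt x)⁻¹ * (lt x ^ (-(m - 1)) * v * lt x ^ (m - 1)) := by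
          rw [zpow_sub_one, neg_sub, sub_eq_add_neg, zpow_add, zpow_one]
          simp [mul_assoc]
        rw [Perm.mul_apply (lt x)⁻¹ y, ← Perm.mul_apply, this, Perm.mul_apply, ih]
  simpa using key _ hu 0

theorem pow_mul_pow (x : Q) (m n : ℤ) : (lt x ^ m) 1 * (lt x ^ n) 1 = (lt x ^ (m + n)) 1 := by
  rw [← lt_apply, lt_zpow, zpow_add]; rfl

theorem pow_mul_pow_mul (x : Q) (m n : ℤ) (z : Q) :
    (lt x ^ m) 1 * (lt x ^ n) 1 * z = (lt x ^ m) 1 * ((lt x ^ n) 1 * z) := by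
  rw [pow_mul_pow]
  simp only [← lt_apply]
  rw [lt_zpow, lt_zpow, lt_zpow, zpow_add]
  rfl

theorem ti_fix {x y : Q} : ti x y = y ↔ y * x = x * y := by
  rw [ti_apply, inv_mul_eq]

theorem ki_fix {x y z : Q} : ki x z y = y ↔ x * y * z = x * (y * z) := by
  rw [← mul_right_inj (x := z), ← mul_left_inj (x := x), ki_mul]

theorem ri_fix {x y z : Q} : ri x z y = y ↔ y * x * z = y * (x * z) := by
  rw [← mul_right_inj (x := x * z), ri_mul]

theorem li_fix {x y z : Q} : li x y z = z ↔ y * (x * z) = y * x * z := by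
  rw [← mul_left_inj (x := y * x), mul_li]

theorem ti_fix_A {x u w : Q} (hu : u ∈ A x) (hw : w ∈ A x) : ti u w = w := by
  refine fix_A_of_fix_pow (ti_mem u) (fun n => ?_) hw
  have : ti ((lt x ^ n) 1) u = u := by
    refine fix_A_of_fix_pow (ti_mem _) (fun m => ?_) hu
    rw [ti_fix, pow_mul_pow, pow_mul_pow, add_comm]
  rw [ti_fix] at this ⊢
  exact this.symm

theorem ki_fix_A {x u w : Q} (z : Q) (hu : u ∈ A x) (hw : w ∈ A x) : ki u z w = w := by
  refine fix_A_of_fix_pow (ki_mem u z) (fun n => ?_) hw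
  have : ri ((lt x ^ n) 1) z u = u := by
    refine fix_A_of_fix_pow (ri_mem _ _) (fun m => ?_) hu
    rw [ri_fix, pow_mul_pow_mul]
  rw [ri_fix] at this
  rwa [ki_fix]

theorem ri_fix_A {x u w : Q} (z : Q) (hu : u ∈ A x) (hw : w ∈ A x) : ri u z w = w := by
  rw [ri_fix]
  exact ki_fix.1 (ki_fix_A z hw hu)

theorem A_assoc {x u w : Q} (hu : u ∈ A x) (hw : w ∈ A x) (z : Q) : u * w * z = u * (w * z) :=
  ki_fix.1 (ki_fix_A z hu hw)

theorem A_comm {x u w : Q} (hu : u ∈ A x) (hw : w ∈ A x) : u * w = w * u :=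
  ti_fix.1 (ti_fix_A hw hu)

theorem A_lt_mul {x u w : Q} (hu : u ∈ A x) (hw : w ∈ A x) : lt (u * w) = lt u * lt w := by
  ext z; exact A_assoc hu hw z

/-- The elements of the multiplication group fixing `A x` pointwise. -/
def V (x : Q) : Subgroup (Perm Q) where
  carrier := {v | v ∈ G Q ∧ ∀ u ∈ A x, v u = u}
  one_mem' := ⟨one_mem _, fun _ _ => rfl⟩
  mul_mem' := fun ha hb => ⟨mul_mem ha.1 hb.1, fun u hu => by
    rw [Perm.mul_apply, hb.2 u hu, ha.2 u hu]⟩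
  inv_mem' := fun ha => ⟨inv_mem ha.1, fun u hu => by
    rw [Perm.inv_eq_iff_eq, ha.2 u hu]⟩

theorem ti_V {x u : Q} (hu : u ∈ A x) : ti u ∈ V x := ⟨ti_memG u, fun _ hw => ti_fix_A hu hw⟩
theorem ki_V {x u : Q} (z : Q) (hu : u ∈ A x) : ki u z ∈ V x :=
  ⟨ki_memG u z, fun _ hw => ki_fix_A z hu hw⟩
theorem ri_V {x u : Q} (z : Q) (hu : u ∈ A x) : ri u z ∈ V x :=
  ⟨ri_memG u z, fun _ hw => ri_fix_A z hu hw⟩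

theorem V_H {x : Q} {v : Perm Q} (hv : v ∈ V x) : v ∈ H Q := mem_H hv.1 (hv.2 1 (A_one x))

/-! ### The subloop of differences -/

/-- The subgroup generated by the conjugates of `H` by translations from `A x`. -/
def M (x : Q) : Subgroup (Perm Q) :=
  Subgroup.closure {g | ∃ u ∈ A x, ∃ h ∈ H Q, g = lt u * h * (lt u)⁻¹}

/-- The orbit of `1` under `M x`. -/
def D (x : Q) : Set Q := {s | lt s ∈ M x}

theorem conj_mem_M {x u : Q} {h : Perm Q} (hu : u ∈ A x) (hh : h ∈ H Q) :
    lt u * h * (lt u)⁻¹ ∈ M x := Subgroup.subset_closure ⟨u, hu, h, hh, rfl⟩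

theorem H_le_M (x : Q) : H Q ≤ M x := fun h hh => by
  simpa using conj_mem_M (A_one x) hh

theorem M_le_PA (x : Q) : M x ≤ PA x := by
  refine (Subgroup.closure_le _).2 ?_
  rintro a ⟨u, hu, h, hh, rfl⟩
  exact mul_mem (mul_mem hu (H_le_PA x hh)) (inv_mem hu)

theorem D_le_A (x : Q) : D x ⊆ A x := fun _ hs => M_le_PA x hs

theorem V_comm_M {x : Q} {v m : Perm Q} (hv : v ∈ V x) (hm : m ∈ M x) : v * m = m * v := by
  have : M x ≤ Subgroup.centralizer {v} := by
    refine (Subgroup.closure_le _).2 ?_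
    rintro a ⟨u, hu, h, hh, rfl⟩
    refine Subgroup.mem_centralizer_iff.2 ?_
    rintro _ rfl
    refine comm_of_fix hv.1 (mul_mem (mul_mem (lt_mem u) (H_le_G hh)) (inv_mem (lt_mem u))) u
      (hv.2 u hu) ?_
    simp [H_one hh]
  exact Subgroup.mem_centralizer_iff.1 (this hm) v rfl

theorem V_mul_left {x s : Q} {v : Perm Q} (hv : v ∈ V x) (hs : s ∈ D x) (z : Q) :
    v (s * z) = s * v z := congrArg (fun k : Perm Q => k z) (V_comm_M hv hs)

theorem V_mul_right {x s : Q} {v : Perm Q} (hv : v ∈ V x) (hs : s ∈ D x) (z : Q) :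
    v (z * s) = v z * s :=
  congrArg (fun k : Perm Q => k z) (V_comm_M hv (rt_mem_of_lt_mem (H_le_M x) hs))

theorem D_mul {x u v : Q} (hu : u ∈ D x) (hv : v ∈ D x) : u * v ∈ D x :=
  lt_mul_mem (H_le_M x) hu hv

theorem D_inv {x u : Q} (hu : u ∈ D x) : u⁻¹ ∈ D x :=
  lt_inv_mem (P := M x) hu

theorem D_app {x u : Q} {h : Perm Q} (hh : h ∈ H Q) (hu : u ∈ D x) : h u ∈ D x :=
  lt_app_mem' (H_le_M x) hh hu

theorem M_eq {p q : Q} (h : A p = A q) : M p = M q := by simp only [M, h]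
theorem D_eq {p q : Q} (h : A p = A q) : D p = D q := by simp only [D, M, h]
theorem A_eq {p q : Q} (h : p ∈ A q) (h' : q ∈ A p) : A p = A q :=
  subset_antisymm (A_le h) (A_le h')

theorem A_eq_inv (p : Q) : A p⁻¹ = A p :=
  A_eq (A_inv (A_self p)) (by simpa using A_inv (A_self p⁻¹))

theorem A_eq_app {h : Perm Q} (hh : h ∈ H Q) (p : Q) : A (h p) = A p :=
  A_eq (A_app hh (A_self p)) (by simpa using A_app (inv_mem hh) (A_self (h p)))

theorem cg_M_app {x u : Q} {h : Perm Q} (hh : h ∈ H Q) (hu : u ∈ A x) : Cg (M x) (h u) u := by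
  have h1 : Cg (M x) u (h u) := by
    rw [cg_iff (H_le_M x)]
    have h2 := conj_mem_M (A_inv hu) hh
    have h3 := lt_app_mem (H_le_M x) ((M_le_PA x).trans (PA_le_G x)) h2
    simpa [← lt_inv] using h3
  exact h1.symm

/-! ### Left inner mappings as pseudoautomorphisms -/

/-- The companion of `li p q`. -/
def cp (p q : Q) : Q := q * p * (q⁻¹ * p⁻¹)

theorem autotopism (x y z : Q) : x * (y * z) = x * (y * x) * (x⁻¹ * z) := by
  rw [← bol, mul_inv_l]

theorem cp_mul_li_mul (p q y z : Q) :
    cp p q * li p q (y * z) = (cp p q * li p q y) * li p q z := by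
  have key : ∀ y z : Q, q * p * (q⁻¹ * (p⁻¹ * (y * z))) =
      q * p * (q⁻¹ * (p⁻¹ * y)) * li p q z := by
    intro y z
    have h1 : p⁻¹ * (y * z) = p⁻¹ * (y * p⁻¹) * (p * z) := by
      simpa using autotopism p⁻¹ y z
    have h2 (a b : Q) : q⁻¹ * (a * b) = q⁻¹ * (a * q⁻¹) * (q * b) := by
      simpa using autotopism q⁻¹ a b
    have h3 (a b : Q) := autotopism (q * p) a b
    rw [h1, h2, h3, li_apply]
    have e := h1.trans (congrArg (fun t => t) rfl)
    have e1 : q * p * ((q⁻¹ * (p⁻¹ * (y * p⁻¹) * q⁻¹)) * (q * p)) =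
        q * p * (q⁻¹ * (p⁻¹ * y)) := by
      congr 1
      have := h2 (p⁻¹ * (y * p⁻¹)) p
      rw [← this]
      congr 1
      rw [← bol p⁻¹ y p]
      simp
    rw [e1]
  have k1 (z : Q) : q * p * (q⁻¹ * (p⁻¹ * z)) = cp p q * li p q z := by
    simpa [cp] using key 1 z
  rw [← k1, ← k1]
  exact key y z

theorem li_mul_left (p q y z : Q) :
    li p q (y * z) = li p q y * ((li (li p q y) (cp p q))⁻¹ (li p q z)) := by
  rw [← mul_left_inj (x := cp p q), cp_mul_li_mul]
  set k := li (li p q y) (cp p q) with hk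
  have := mul_li (li p q y) (cp p q) (k⁻¹ (li p q z))
  rw [← this, ← hk]; simp

theorem li_mul_right (p q y z : Q) :
    li p q (y * z) = ki (cp p q) (li p q z) (li p q y) * li p q z := by
  rw [← mul_left_inj (x := cp p q), cp_mul_li_mul, ki_mul]

theorem ti_li (p q y : Q) (z : Q) :
    ti y z = ti (li p q y) (li (li p q y) (cp p q) (ki (cp p q) (li p q y) z)) := by
  have h : ∀ z, li p q (ti y ((li p q)⁻¹ z)) =
      ti (li p q y) (li (li p q y) (cp p q) (ki (cp p q) (li p q y) z)) := by
    intro z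
    set w := (li p q)⁻¹ z with hw
    have hz : z = li p q w := by simp [hw]
    have h1 := li_mul_left p q y (ti y w)
    rw [mul_ti, li_mul_right p q w y, ← hz, eq_comm, ← eq_inv_mul] at h1
    rw [Perm.inv_eq_iff_eq] at h1
    rw [h1, H_comm_apply (ti_mem _) (li_mem _ _), ti_apply]
  rw [← h, H_comm_apply (li_mem p q) (ti_mem y)]
  simp

theorem li_mem_A_left {p q z : Q} : z⁻¹ * li p q z ∈ A p := by
  rw [mem_A, ← cg_iff (H_le_PA p), li_apply]
  have hp := cg_A (A_self p)
  refine Cg.of_mul_left (H_le_PA p) (q * p) ?_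
  rw [mul_inv_l]
  refine Cg.trans (y := q * z) ?_ ?_
  · simpa using ((hp.mul_left (H_le_PA p) q).mul_right (H_le_PA p) z).symm
  · simpa using (hp.mul_right (H_le_PA p) z).mul_left (H_le_PA p) q

theorem li_mem_A_right {p q z : Q} : z⁻¹ * li p q z ∈ A q := by
  rw [mem_A, ← cg_iff (H_le_PA q), li_apply]
  have hp := cg_A (A_self q)
  refine Cg.of_mul_left (H_le_PA q) (q * p) ?_
  rw [mul_inv_l]
  refine Cg.trans (y := p * z) ?_ ?_
  · simpa using ((hp.mul_right (H_le_PA q) p).mul_right (H_le_PA q) z).symm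
  · simpa using hp.mul_right (H_le_PA q) (p * z)

theorem diff_mem_A {h : Perm Q} (hh : h ∈ H Q) (z : Q) : z⁻¹ * h z ∈ A z :=
  A_mul (A_inv (A_self z)) (A_app hh (A_self z))

theorem cp_mem_left (p q : Q) : cp p q ∈ A p := by
  rw [mem_A, ← cg_one]
  have hp := cg_A (A_self p)
  have h := Cg.mul (H_le_PA p) (hp.mul_left (H_le_PA p) q)
    ((hp.inv (H_le_PA p)).mul_left (H_le_PA p) q⁻¹)
  simpa [cp] using h

theorem cp_mem_right (p q : Q) : cp p q ∈ A q := by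
  rw [mem_A, ← cg_one]
  have hp := cg_A (A_self q)
  have h := Cg.mul (H_le_PA q) (hp.mul_right (H_le_PA q) p)
    ((hp.inv (H_le_PA q)).mul_right (H_le_PA q) p⁻¹)
  simpa [cp] using h

/-- Membership in one of the two subloops attached to `li p q`. -/
theorem li_mul_of_mem {p q s : Q} (hs : s ∈ A p ∨ s ∈ A q) (z : Q) :
    li p q (s * z) = li p q s * li p q z := by
  have h1 : li (li p q s) (cp p q) = 1 := by
    have : lt (cp p q * li p q s) = lt (cp p q) * lt (li p q s) := by
      rcases hs with hs | hs
      · exact A_lt_mul (cp_mem_left p q) (A_app (li_mem p q) hs)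
      · exact A_lt_mul (cp_mem_right p q) (A_app (li_mem p q) hs)
    rw [li, this]; group
  rw [li_mul_left, h1]; simp

theorem li_inv_of_mem {p q s : Q} (hs : s ∈ A p ∨ s ∈ A q) : li p q s⁻¹ = (li p q s)⁻¹ := by
  have := li_mul_of_mem hs s⁻¹
  rw [← mul_left_inj (x := li p q s), ← this]
  simp

theorem ti_mul_right {u y r s : Q} (hs : s ∈ A u) (hr : r ∈ A u) (hy : r ∈ A y) :
    ti (y * r) s = ti y s := by
  have h1 : s * (y * r) = y * r * ti y s := by
    have hry : r * y = y * r := A_comm hy (A_self y)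
    rw [← hry, ← A_assoc hs hr, A_comm hs hr, A_assoc hr hs, ← mul_ti y s,
      A_assoc hy (A_self y)]
  rw [← mul_left_inj (x := y * r), mul_ti, h1]

theorem li_cp_fix {p q s : Q} (hs : s ∈ A p ∨ s ∈ A q) (y : Q) : li y (cp p q) s = s := by
  have key : ∀ y, li (li p q y) (cp p q) s = s := by
    intro y
    have h1 := ti_li p q y s
    have h2 : ki (cp p q) (li p q y) s = s := by
      rcases hs with hs | hs
      · exact ki_fix_A _ (cp_mem_left p q) hs
      · exact ki_fix_A _ (cp_mem_right p q) hs
    have h3 : ti (li p q y) s = ti y s := by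
      have e : li p q y = y * (y⁻¹ * li p q y) := by simp
      rw [e]
      rcases hs with hs | hs
      · exact ti_mul_right hs li_mem_A_left (diff_mem_A (li_mem p q) y)
      · exact ti_mul_right hs li_mem_A_right (diff_mem_A (li_mem p q) y)
    rw [h2, ← h3] at h1
    exact ((ti _).injective h1).symm
  simpa using key ((li p q)⁻¹ y)

/-- `li p q` is multiplicative when the right factor lies in `A p` or `A q`. -/
theorem li_mul_of_mem' {p q s : Q} (hs : s ∈ A p ∨ s ∈ A q) (y : Q) :
    li p q (y * s) = li p q y * li p q s := by
  rw [li_mul_left]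
  congr 1
  rw [Perm.inv_eq_iff_eq]
  refine (li_cp_fix (hs.imp ?_ ?_) _).symm <;> exact A_app (li_mem p q)

/-! ### Commutators -/

/-- The commutator `z⁻¹ T_w z`. -/
def cm (z w : Q) : Q := z⁻¹ * ti w z

theorem mul_cm (z w : Q) : z * cm z w = ti w z := by simp [cm]

theorem mul_mul_cm (z w : Q) : w * (z * cm z w) = z * w := by rw [mul_cm, mul_ti]

theorem cm_mem_left (z w : Q) : cm z w ∈ A z := diff_mem_A (ti_mem w) z

theorem cm_mem_right (z w : Q) : cm z w ∈ A w := by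
  rw [cm, mem_A, ← cg_iff (H_le_PA w)]
  have hp := cg_A (A_self w)
  refine Cg.of_mul_left (H_le_PA w) w ?_
  rw [mul_ti]
  refine Cg.trans (y := z) ?_ ?_
  · simpa using (hp.mul_right (H_le_PA w) z).symm
  · simpa using hp.mul_left (H_le_PA w) z

theorem cm_mul_cm (z y : Q) : cm y z * cm z y = 1 := by
  set a := cm z y with ha
  set b := cm y z with hb
  have az : a ∈ A z := cm_mem_left z y
  have ay : a ∈ A y := cm_mem_right z y
  have bz : b ∈ A z := cm_mem_right y z
  have by' : b ∈ A y := cm_mem_left y z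
  have h1 : z * y = y * (z * a) := (mul_mul_cm z y).symm
  have h2 : y * z = z * (y * b) := (mul_mul_cm y z).symm
  have h3 : z * y = z * (y * (b * a)) := by
    conv_lhs => rw [h1]
    rw [A_comm (A_self z) az, ← A_assoc (A_self y) ay, A_comm (A_self y) ay,
      A_assoc ay (A_self y), h2, ← A_assoc az (A_self z), A_comm az (A_self z),
      A_assoc (A_self z) az, ← A_assoc ay (A_self y), A_comm ay (A_self y),
      A_assoc (A_self y) ay, A_comm by' ay]
  rw [mul_left_inj] at h3
  have : y * 1 = y * (b * a) := by simpa using h3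
  rw [mul_left_inj] at this
  exact this.symm

theorem cm_symm (z y : Q) : cm z y = (cm y z)⁻¹ := by
  rw [← mul_left_inj (x := cm y z), cm_mul_cm]; simp

theorem cm_li_left {p q w : Q} (hw : w ∈ A p ∨ w ∈ A q) (z : Q) :
    cm (li p q z) w = li p q (cm z w) := by
  have h1 := H_comm_apply (li_mem p q) (ti_mem w) z
  rw [← mul_cm, li_mul_of_mem', ← mul_cm (li p q z) w, mul_left_inj] at h1
  · exact h1.symm
  · exact hw.imp (fun h => A_le h (cm_mem_right z w)) (fun h => A_le h (cm_mem_right z w))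

theorem cm_li_fix {p q w : Q} (hw : w ∈ A p ∨ w ∈ A q) (z : Q) :
    cm (li p q z) w = cm z w := by
  rw [cm_symm, cm_symm z w]
  congr 1
  rw [cm, cm]
  congr 1
  have e : li p q z = z * (z⁻¹ * li p q z) := by simp
  rw [e]
  rcases hw with hw | hw
  · exact ti_mul_right hw li_mem_A_left (diff_mem_A (li_mem p q) z)
  · exact ti_mul_right hw li_mem_A_right (diff_mem_A (li_mem p q) z)

theorem li_cm_fix {p q w : Q} (hw : w ∈ A p ∨ w ∈ A q) (z : Q) :
    li p q (cm z w) = cm z w := by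
  rw [← cm_li_left hw, cm_li_fix hw]

/-! ### Membership in `D p` -/

theorem diff_mem_D {x u : Q} {h : Perm Q} (hh : h ∈ H Q) (hu : u ∈ A x) : u⁻¹ * h u ∈ D x :=
  (cg_iff (H_le_M x)).1 (cg_M_app hh hu).symm

section Central

variable (p : Q)

theorem cg_comm (w : Q) : Cg (M p) (p * w) (w * p) := by
  have := (cg_M_app (ti_mem w) (A_self p)).mul_left (H_le_M p) w
  rwa [mul_ti] at this

theorem cg_assoc_right (x y : Q) : Cg (M p) (x * (y * p)) (x * y * p) := by
  have := (cg_M_app (li_mem y x) (A_self p)).mul_left (H_le_M p) (x * y)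
  rwa [mul_li] at this

theorem cg_assoc_left (x y : Q) : Cg (M p) (p * x * y) (p * (x * y)) := by
  have := (cg_M_app (ri_mem x y) (A_self p)).mul_right (H_le_M p) (x * y)
  rwa [ri_mul] at this

theorem cg_assoc_mid (x y : Q) : Cg (M p) (x * p * y) (x * (p * y)) := by
  have := ((cg_M_app (ki_mem x y) (A_self p)).mul_right (H_le_M p) y).mul_left (H_le_M p) x
  rwa [ki_mul] at this

theorem cg_li_left (q w : Q) : Cg (M p) (li p q w) w := by
  refine Cg.of_mul_left (H_le_M p) (q * p) ?_
  rw [mul_li]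
  exact (cg_assoc_mid p q w).symm

theorem cg_li_right (q w : Q) : Cg (M p) (li q p w) w := by
  refine Cg.of_mul_left (H_le_M p) (p * q) ?_
  rw [mul_li]
  exact (cg_assoc_left p q w).symm

theorem cg_ki_left (y w : Q) : Cg (M p) (ki p y w) w := by
  refine Cg.of_mul_right (H_le_M p) y (Cg.of_mul_left (H_le_M p) p ?_)
  rw [ki_mul]
  exact cg_assoc_left p w y

theorem cg_ki_right (y w : Q) : Cg (M p) (ki y p w) w := by
  refine Cg.of_mul_right (H_le_M p) p (Cg.of_mul_left (H_le_M p) y ?_)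
  rw [ki_mul]
  exact (cg_assoc_right p y w).symm

theorem cg_ri_left (y w : Q) : Cg (M p) (ri p y w) w := by
  refine Cg.of_mul_right (H_le_M p) (p * y) ?_
  rw [ri_mul]
  exact cg_assoc_mid p w y

theorem cg_ti (w : Q) : Cg (M p) (ti p w) w := by
  refine Cg.of_mul_left (H_le_M p) p ?_
  rw [mul_ti]
  exact (cg_comm p w).symm

end Central

theorem mem_D_of_cg {p w w' : Q} (h : Cg (M p) w' w) : w⁻¹ * w' ∈ D p :=
  (cg_iff (H_le_M p)).1 h.symm

/-! ### The subloop fixed by left inner mappings -/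

/-- Elements of `D p` fixed by all `li` involving a generator of `A p`. -/
def S (p : Q) : Set Q :=
  {s | s ∈ D p ∧ ∀ w p' : Q, A p' = A p → li p' w s = s ∧ li w p' s = s}

theorem S_le_D {p : Q} : S p ⊆ D p := fun _ h => h.1

theorem S_le_A {p : Q} : S p ⊆ A p := fun _ h => D_le_A p h.1

theorem S_li_left {p s : Q} (hs : s ∈ S p) (w : Q) : li p w s = s := (hs.2 w p rfl).1

theorem S_li_right {p s : Q} (hs : s ∈ S p) (w : Q) : li w p s = s := (hs.2 w p rfl).2

theorem S_mul_assoc_left {p s : Q} (hs : s ∈ S p) (w : Q) : w * (p * s) = w * p * s :=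
  li_fix.1 (S_li_left hs w)

theorem S_mul_assoc_right {p s : Q} (hs : s ∈ S p) (w : Q) : p * (w * s) = p * w * s :=
  li_fix.1 (S_li_right hs w)

theorem S_eq {p q : Q} (h : A p = A q) : S p = S q := by
  simp only [S, D_eq h, h]

theorem S_app {p s : Q} {h : Perm Q} (hh : h ∈ H Q) (hs : s ∈ S p) : h s ∈ S p :=
  ⟨D_app hh hs.1, fun w p' hp => by
    rw [H_comm_apply (li_mem _ _) hh, H_comm_apply (li_mem _ _) hh, (hs.2 w p' hp).1,
      (hs.2 w p' hp).2]
    exact ⟨rfl, rfl⟩⟩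

theorem S_mul {p s t : Q} (hs : s ∈ S p) (ht : t ∈ S p) : s * t ∈ S p :=
  ⟨D_mul hs.1 ht.1, fun w p' hp => by
    have h : s ∈ A p' := hp ▸ S_le_A hs
    rw [li_mul_of_mem (Or.inl h), li_mul_of_mem (Or.inr h), (hs.2 w p' hp).1, (hs.2 w p' hp).2,
      (ht.2 w p' hp).1, (ht.2 w p' hp).2]
    exact ⟨rfl, rfl⟩⟩

theorem S_inv {p s : Q} (hs : s ∈ S p) : s⁻¹ ∈ S p :=
  ⟨D_inv hs.1, fun w p' hp => by
    have h : s ∈ A p' := hp ▸ S_le_A hs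
    rw [li_inv_of_mem (Or.inl h), li_inv_of_mem (Or.inr h), (hs.2 w p' hp).1, (hs.2 w p' hp).2]
    exact ⟨rfl, rfl⟩⟩

theorem cm_mem_S_right (q p : Q) : cm q p ∈ S p := by
  constructor
  · rw [cm_symm]
    exact D_inv (diff_mem_D (ti_mem q) (A_self p))
  · intro w p' hp
    have h : p ∈ A p' := hp ▸ A_self p
    exact ⟨li_cm_fix (Or.inl h) q, li_cm_fix (Or.inr h) q⟩

theorem cm_mem_S_left (p q : Q) : cm p q ∈ S p := by
  rw [cm_symm]; exact S_inv (cm_mem_S_right q p)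

theorem li_mul_S_left {p s : Q} (hs : s ∈ S p) (w y : Q) : li p w (y * s) = li p w y * s := by
  rw [li_mul_of_mem' (Or.inl (S_le_A hs)), S_li_left hs]

theorem li_mul_S_right {p s : Q} (hs : s ∈ S p) (w y : Q) : li w p (y * s) = li w p y * s := by
  rw [li_mul_of_mem' (Or.inr (S_le_A hs)), S_li_right hs]

theorem mem_S_of_V {p w : Q} {v : Perm Q} (hv : v ∈ V p) (ht : w⁻¹ * v w ∈ D p) :
    w⁻¹ * v w ∈ S p := by
  refine ⟨ht, fun u p' hp => ?_⟩
  set t := w⁻¹ * v w with h_t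
  have hvw : w * t = v w := by simp [h_t]
  have htw : t ∈ A w := diff_mem_A (V_H hv) w
  have hp' : t ∈ A p' := hp ▸ D_le_A p ht
  have key : ∀ φ ∈ H Q, φ (w * t) = φ w * φ t → Cg (M p) (φ w) w → φ t = t := by
    intro φ hφ hmul hcg
    set e := w⁻¹ * φ w with h_e
    have he : e ∈ D p := mem_D_of_cg hcg
    have hew : e ∈ A w := diff_mem_A hφ w
    have hφw : φ w = w * e := by simp [h_e]
    rw [hvw, H_comm_apply hφ (V_H hv), hφw, V_mul_right hv he, ← hvw,
      A_comm (A_mul (A_self w) htw) hew, ← A_assoc hew (A_self w), A_comm hew (A_self w),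
      mul_left_inj] at hmul
    exact hmul.symm
  have hM : M p' = M p := M_eq hp
  exact ⟨key _ (li_mem _ _) (li_mul_of_mem' (Or.inl hp') w) (hM ▸ cg_li_left p' u w),
    key _ (li_mem _ _) (li_mul_of_mem' (Or.inr hp') w) (hM ▸ cg_li_right p' u w)⟩

theorem S_ki_right {p s : Q} (hs : s ∈ S p) (w : Q) : ki w p s = s := by
  rw [ki_fix, ← mul_ti p (w * s), V_mul_right (ti_V (A_self p)) (S_le_D hs),
    S_mul_assoc_right hs, mul_ti, ← S_mul_assoc_left hs, A_comm (A_self p) (S_le_A hs)]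

theorem li_S_congr {p s : Q} (hs : s ∈ S p) (z w : Q) : li (z * p) w s = li z w s := by
  set ψ := li z w with hψ
  have hψs : ψ s ∈ S (ψ p) := by
    rw [S_eq (A_eq_app (li_mem z w) p)]
    exact S_app (li_mem z w) hs
  have h1 : ψ (p * s) = ψ p * ψ s := by
    rw [hψ, li_mul_left]
    congr 1
    rw [Perm.inv_eq_iff_eq]
    exact (S_li_left hψs _).symm
  rw [← mul_left_inj (x := w * (z * p)), mul_li, ← S_mul_assoc_left hs, ← mul_li z w (p * s),
    ← hψ, h1, S_mul_assoc_left hψs, hψ, mul_li]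

theorem mul_S_mul {p s : Q} (hs : s ∈ S p) (x : Q) : x * s * p = x * p * s := by
  rw [ki_fix.1 (S_ki_right hs x), A_comm (S_le_A hs) (A_self p), S_mul_assoc_left hs]

theorem ki_mul_S {p s : Q} (hs : s ∈ S p) (w z : Q) : ki w p (z * s) = ki w p z * s := by
  set z' := ki w p z with hz'
  have hx : w * (z' * p) = w * z * p := ki_mul w p z
  have h1 : w * (z * s) = w * z * li z w s := (mul_li z w s).symm
  have hS := S_app (li_mem z w) hs
  rw [← mul_right_inj (x := p), ← mul_left_inj (x := w), ki_mul, h1, mul_S_mul hS, mul_S_mul hs,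
    ← hx]
  have h2 := mul_li (w * z * p) w⁻¹ (li z w s)
  rw [li_S_congr hS] at h2
  have h3 : li (w * z) w⁻¹ (li z w s) = s := by
    have := mul_li (w * z) w⁻¹ (li z w s)
    rw [mul_li z w s, inv_mul_l, inv_mul_l, mul_left_inj] at this
    exact this
  rw [h3, ← hx, inv_mul_l] at h2
  rw [h2, mul_inv_l]

theorem li_mem_S_right (q p z : Q) : z⁻¹ * li q p z ∈ S p := by
  have hk : (ki p z)⁻¹ ∈ V p := inv_mem (ki_V z (A_self p))
  set r := q⁻¹ * (ki p z)⁻¹ q with hr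
  have hrS : r ∈ S p := by
    refine mem_S_of_V hk (mem_D_of_cg ?_)
    simpa using (cg_ki_left p z ((ki p z)⁻¹ q)).symm
  have hqr : (ki p z)⁻¹ q = q * r := by simp [hr]
  have h1 : p * (q * z) = p * q * r * z := by
    rw [← S_mul_assoc_right hrS, ← hqr, ← ki_mul]
    simp
  have h2 : p * (q * z) = p * q * (z * ti z (ki (p * q) z r)) := by
    rw [mul_ti, ki_mul, h1]
  rw [← mul_li, mul_left_inj] at h2
  rw [h2, inv_mul_l]
  exact S_app (ti_mem _) (S_app (ki_mem _ _) hrS)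

theorem inv_diff {z : Q} {v : Perm Q} (hv : v ∈ H Q)
    (hmul : v (z * (z⁻¹ * v⁻¹ z)) = v z * (z⁻¹ * v⁻¹ z)) :
    z⁻¹ * v⁻¹ z = (z⁻¹ * v z)⁻¹ := by
  set b := z⁻¹ * v⁻¹ z with hb
  set a := z⁻¹ * v z with ha
  have haz : a ∈ A z := diff_mem_A hv z
  have hbz : b ∈ A z := diff_mem_A (inv_mem hv) z
  have h1 : z = z * a * b := by
    have : z * a = v z := by simp [ha]
    rw [this, ← hmul]; simp [hb]
  rw [A_assoc (A_self z) haz] at h1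
  have h4 : z * 1 = z * (a * b) := by simpa using h1
  rw [mul_left_inj] at h4
  rw [← mul_left_inj (x := a), ← h4]; simp

theorem li_eq_inv (p q : Q) : li p q = (li (q * p) p)⁻¹ := by
  rw [li_def, li_def, lt_bol]; simp [mul_assoc]

theorem li_mem_S_left (p q z : Q) : z⁻¹ * li p q z ∈ S p := by
  have hS : z⁻¹ * li (q * p) p z ∈ S p := li_mem_S_right _ _ _
  have h1 : (li p q)⁻¹ = li (q * p) p := by rw [li_eq_inv p q, inv_inv]
  have := inv_diff (li_mem p q) (z := z) (li_mul_S_left (h1 ▸ hS) q z)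
  rw [h1] at this
  rw [← inv_inv' (z⁻¹ * li p q z), ← this]
  exact S_inv hS

theorem ki_mem_S_right (w p z : Q) : z⁻¹ * ki w p z ∈ S p := by
  set t := z⁻¹ * ki w p z with ht
  have hzt : ki w p z = z * t := by simp [ht]
  have htD : t ∈ D p := mem_D_of_cg (cg_ki_right p w z)
  have htz : t ∈ A z := diff_mem_A (ki_mem _ _) z
  refine ⟨htD, fun u p' hp => ?_⟩
  have htp : t ∈ A p' := hp ▸ D_le_A p htD
  have key : ∀ φ ∈ H Q, φ (z * t) = φ z * φ t → z⁻¹ * φ z ∈ S p → φ t = t := by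
    intro φ hφ hmul hS
    set e := z⁻¹ * φ z with he
    have hez : e ∈ A z := diff_mem_A hφ z
    have hφz : φ z = z * e := by simp [he]
    rw [← hzt, H_comm_apply hφ (ki_mem w p), hφz, ki_mul_S hS, hzt,
      A_comm (A_mul (A_self z) htz) hez, ← A_assoc hez (A_self z), A_comm hez (A_self z),
      mul_left_inj] at hmul
    exact hmul.symm
  rw [← S_eq hp] at key
  exact ⟨key _ (li_mem _ _) (li_mul_of_mem' (Or.inl htp) z) (li_mem_S_left _ _ _),
    key _ (li_mem _ _) (li_mul_of_mem' (Or.inr htp) z) (li_mem_S_right _ _ _)⟩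

/-! ### The associator -/

/-- The element `r` with `x * (y * z) = (x * y) * z * r`. -/
def as (x y z : Q) : Q := y⁻¹ * (ki x z)⁻¹ y

theorem ki_inv_as (x y z : Q) : (ki x z)⁻¹ y = y * as x y z := by simp [as]

theorem as_mem_left (x y z : Q) : as x y z ∈ S x := by
  refine mem_S_of_V (inv_mem (ki_V z (A_self x))) (mem_D_of_cg ?_)
  simpa using (cg_ki_left x z ((ki x z)⁻¹ y)).symm

theorem as_mem_A_mid (x y z : Q) : as x y z ∈ A y := diff_mem_A (inv_mem (ki_mem _ _)) y

theorem as_mem_right (x y z : Q) : as x y z ∈ S z := by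
  rw [as, inv_diff (ki_mem x z) (V_mul_right (ki_V z (A_self x)) (S_le_D (as_mem_left x y z)) y)]
  exact S_inv (ki_mem_S_right x z y)

theorem mul_as_mul (x y z : Q) : x * as x y z * y * z = x * (y * z) := by
  have h1 : x * (y * z) = x * (y * as x y z) * z := by
    rw [← ki_inv_as, ← ki_mul]; simp
  rw [h1, ← A_comm (as_mem_A_mid x y z) (A_self y),
    ← A_assoc (A_self x) (S_le_A (as_mem_left x y z))]

theorem ri_inv_as (x y z : Q) : (ri y z)⁻¹ x = x * as x y z := by
  rw [Perm.inv_eq_iff_eq, ← mul_right_inj (x := y * z), ri_mul, mul_as_mul]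

theorem as_mem_mid (x y z : Q) : as x y z ∈ S y := by
  have h : as x y z = x⁻¹ * (ri y z)⁻¹ x := by rw [ri_inv_as]; simp
  rw [h]
  refine mem_S_of_V (inv_mem (ri_V z (A_self y))) (mem_D_of_cg ?_)
  simpa using (cg_ri_left y z ((ri y z)⁻¹ x)).symm

theorem mul_mul_as (x y z : Q) : x * y * (z * as x y z) = x * (y * z) := by
  have h1 : x * (y * z) = x * (y * as x y z) * z := by
    rw [← ki_inv_as, ← ki_mul]; simp
  rw [h1, S_mul_assoc_right (as_mem_left x y z), ki_fix.1 (S_ki_right (as_mem_right x y z) _),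
    A_comm (A_self z) (S_le_A (as_mem_right x y z))]

theorem li_as (x y z : Q) : li y x z = z * as x y z := by
  rw [← mul_left_inj (x := x * y), mul_li, mul_mul_as]

theorem mul_assoc_as (x y z : Q) : x * y * z * as x y z = x * (y * z) := by
  rw [← mul_mul_as, ← S_mul_assoc_left (as_mem_right x y z)]

/-! ### Inner mappings that are multiplicative along `S` -/

/-- Inner mappings `h` with `h (p * s) = h p * h s` for `s ∈ S p`. -/
def Good (h : Perm Q) : Prop := h ∈ H Q ∧ ∀ p s : Q, s ∈ S p → h (p * s) = h p * h s

theorem Good.inv {h : Perm Q} (hh : Good h) : Good h⁻¹ := by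
  refine ⟨inv_mem hh.1, fun p s hs => ?_⟩
  rw [Perm.inv_eq_iff_eq, hh.2]
  · simp
  · rw [S_eq (A_eq_app (inv_mem hh.1) p)]
    exact S_app (inv_mem hh.1) hs

theorem S_mul_left_comm {p q s : Q} (hs : s ∈ S p) (hq : q ∈ A p) (z : Q) :
    q * (s * z) = s * (q * z) := by
  rw [← A_assoc hq (S_le_A hs), A_comm hq (S_le_A hs), A_assoc (S_le_A hs) hq]

theorem good_li (p q : Q) : Good (li p q) := by
  refine ⟨li_mem p q, fun z s hs => ?_⟩
  rw [li_mul_left]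
  congr 1
  rw [Perm.inv_eq_iff_eq]
  have : li p q s ∈ S (li p q z) := by
    rw [S_eq (A_eq_app (li_mem p q) z)]
    exact S_app (li_mem p q) hs
  exact (S_li_left this _).symm

theorem good_ti (y : Q) : Good (ti y) := by
  refine ⟨ti_mem y, fun w s hs => ?_⟩
  have h1 := S_app (ti_mem y) hs
  have h2 : ti y s ∈ S (ti y w) := by rwa [S_eq (A_eq_app (ti_mem y) w)]
  rw [← mul_left_inj (x := y), mul_ti, ki_fix.1 (ki_fix_A y (A_self w) (S_le_A hs)), ← mul_ti y s,
    S_mul_assoc_right h1, ← mul_ti y w, S_mul_assoc_left h2]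

theorem S_conj_comm {p s : Q} (hs : s ∈ S p) (w z : Q) :
    p * (w * (s * z)) = w * (s * (w⁻¹ * (p * (w * z)))) := by
  have key (u : Q) (hu : u = z ∨ u = s * z) :
      p * (w * u) = w * (ti w p * ((li (ti w p) w)⁻¹ (li w p u))) := by
    have h := mul_li (ti w p) w ((li (ti w p) w)⁻¹ (li w p u))
    rw [← h, mul_ti, ← mul_li]
    simp
  have hA := A_eq_app (ti_mem w) p
  have h2 : (li (ti w p) w)⁻¹ (li w p (s * z)) = s * (li (ti w p) w)⁻¹ (li w p z) := by
    rw [li_mul_of_mem (Or.inr (S_le_A hs)), S_li_right hs, Perm.inv_eq_iff_eq]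
    rw [← S_eq hA] at hs
    rw [li_mul_of_mem (Or.inl (S_le_A hs)), S_li_left hs]
    simp
  rw [key _ (Or.inr rfl), key _ (Or.inl rfl), h2, inv_mul_l,
    S_mul_left_comm hs (A_app (ti_mem w) (A_self p))]

theorem good_ki (w y : Q) : Good (ki w y) := by
  refine ⟨ki_mem w y, fun p s hs => ?_⟩
  set v := ki p y * ti p with hv
  have hvV : v ∈ V p := mul_mem (ki_V y (A_self p)) (ti_V (A_self p))
  set e := w⁻¹ * v w with he
  have hvw : v w = w * e := by simp [he]
  have heD : e ∈ D p := mem_D_of_cg ((cg_ki_left p y (ti p w)).trans (cg_ti p w))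
  have hew : e ∈ A w := diff_mem_A (V_H hvV) w
  set t := ki w y s with ht
  have htS : t ∈ S p := S_app (ki_mem w y) hs
  have hwt : w * s * y = w * (t * y) := (ki_mul w y s).symm
  have base : p * (v w * y) = w * p * y := by
    rw [hv, Perm.mul_apply, ki_mul, mul_ti]
  have h1 : w * (p * s) * y = p * (v w * s * y) := by
    rw [S_mul_assoc_left hs, ← mul_ti p w, ← S_mul_assoc_right hs, ← ki_mul,
      V_mul_right (ki_V y (A_self p)) (S_le_D hs), hv, Perm.mul_apply]
  have h2 : v w * s * y = v w * (t * y) := by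
    have hk : ki e y (w * s) = w * s := by
      rw [V_mul_right (ki_V y (D_le_A p heD)) (S_le_D hs), ki_fix_A y hew (A_self w)]
    rw [hvw, A_comm (A_self w) hew, A_assoc hew (A_self w), ki_fix.1 hk, hwt,
      A_assoc hew (A_self w)]
  have hhp : ki w y p ∈ A p := A_app (ki_mem w y) (A_self p)
  have h3 : p * (v w * (t * y)) = w * (ki w y p * (t * y)) := by
    rw [hvw, A_assoc (A_self w) hew, S_mul_left_comm htS (D_le_A p heD), S_conj_comm htS,
      ← A_assoc (A_self w) hew, ← hvw, base, ← ki_mul, inv_mul_l, S_mul_left_comm htS hhp]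
  rw [← mul_right_inj (x := y), ← mul_left_inj (x := w), ki_mul, h1, h2, h3,
    ki_fix.1 (ki_fix_A y hhp (S_le_A htS))]

theorem ki_as (x y z : Q) : ki x z y = y * (as x y z)⁻¹ := by
  have h := inv_diff (ki_mem x z) (V_mul_right (ki_V z (A_self x)) (S_le_D (as_mem_left x y z)) y)
  rw [as, h]; simp

theorem good_ri (w y : Q) : Good (ri w y) := by
  refine ⟨ri_mem w y, fun p s hs => ?_⟩
  set e := (as p w y)⁻¹ with he
  have hep : e ∈ S p := S_inv (as_mem_left _ _ _)
  have hew : e ∈ S w := S_inv (as_mem_mid _ _ _)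
  have hki : ki p y w = w * e := ki_as p w y
  set t := ri (w * e) y s with ht
  have htA : t ∈ A p := A_app (ri_mem _ _) (S_le_A hs)
  have hRp : ri w y p ∈ A p := A_app (ri_mem _ _) (A_self p)
  have h1 : ri w y (p * s) = ri w y p * t := by
    rw [← mul_right_inj (x := w * y), ri_mul, A_assoc (A_self p) (S_le_A hs), ← ki_mul,
      V_mul_left (ki_V y (A_self p)) (S_le_D hs), hki, ← ri_mul (w * e) y s, ← ht,
      ← A_assoc (A_self p) htA, A_comm (A_self p) htA, A_assoc htA (A_self p), ← hki, ki_mul,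
      ← ri_mul w y p, ← A_assoc htA hRp, A_comm htA hRp]
  have h2 : t = ri w y s := by
    rw [← mul_right_inj (x := e), ← V_mul_right (ri_V y (A_self w)) (S_le_D hew),
      ← mul_right_inj (x := w * y), ri_mul, A_assoc htA (S_le_A hep),
      ← A_assoc (S_le_A hew) (A_self w), A_comm (S_le_A hew) (A_self w), ht, ri_mul,
      A_comm (A_self w) (S_le_A hew), ← A_assoc (S_le_A hs) (S_le_A hep)]
  rw [h1, h2]

/-! ### Action on commutators -/

theorem Good.cm_left {h : Perm Q} (hh : Good h) (z w : Q) : cm (h z) w = h (cm z w) := by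
  have h1 := H_comm_apply hh.1 (ti_mem w) z
  rw [← mul_cm, hh.2 _ _ (cm_mem_S_left z w), ← mul_cm (h z) w, mul_left_inj] at h1
  exact h1.symm

theorem Good.cm_inv {h : Perm Q} (hh : Good h) (z w : Q) : h (cm z w)⁻¹ = (h (cm z w))⁻¹ := by
  have hs := cm_mem_S_left z w
  have h1 : (cm z w)⁻¹ ∈ S (ti w z) := by
    rw [S_eq (A_eq_app (ti_mem w) z)]; exact S_inv hs
  have h2 := hh.2 _ _ h1
  rw [← mul_cm, A_assoc (A_self z) (S_le_A hs), mul_inv_self', mul_one, hh.2 _ _ hs,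
    A_assoc (A_app hh.1 (A_self z)) (A_app hh.1 (S_le_A hs))] at h2
  have h3 : h z * 1 = h z * (h (cm z w) * h (cm z w)⁻¹) := by simpa using h2
  rw [mul_left_inj] at h3
  rw [← mul_left_inj (x := h (cm z w)), ← h3, mul_inv_self']

theorem Good.cm_right {h : Perm Q} (hh : Good h) (z w : Q) : cm z (h w) = h (cm z w) := by
  rw [cm_symm, hh.cm_left, cm_symm z w, hh.cm_inv]

theorem cm_mul_S {y a : Q} (ha : a ∈ S y) (w : Q) : cm (y * a) w = cm y w * cm a w := by
  have h1 := (good_ti w).2 y a ha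
  have e1 : cm a w ∈ A y := A_le (S_le_A ha) (cm_mem_left a w)
  have e2 := cm_mem_left y w
  have e3 := S_le_A ha
  rw [← mul_cm, ← mul_cm y w, ← mul_cm a w, A_assoc (A_self y) e3, A_assoc (A_self y) e2,
    mul_left_inj, ← A_assoc e2 e3, A_comm e2 e3, A_assoc e3 e2, mul_left_inj] at h1
  exact h1

/-- The commutator of an associator with a fourth element. -/
def ex (x y z w : Q) : Q := cm (as x y z) w

theorem Good.cm_swap {h : Perm Q} (hh : Good h) {z w a b : Q} (ha : a ∈ S z) (hb : b ∈ S w)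
    (hz : h z = z * a) (hw : h w = w * b) : cm b z = (cm a w)⁻¹ := by
  have h1 : cm z w * cm a w = h (cm z w) := by rw [← cm_mul_S ha, ← hz, hh.cm_left]
  have h2 : cm w z * cm b z = h (cm w z) := by rw [← cm_mul_S hb, ← hw, hh.cm_left]
  rw [cm_symm w z, hh.cm_inv, ← h1] at h2
  have e1 : cm z w ∈ A z := cm_mem_left z w
  have e2 : cm a w ∈ A z := A_le (S_le_A ha) (cm_mem_left a w)
  have e3 : cm b z ∈ A z := cm_mem_right b z
  have h3 : cm b z = cm z w * (cm z w * cm a w)⁻¹ := by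
    rw [← h2]; simp
  rw [← mul_left_inj (x := cm a w), h3, ← A_assoc e2 e1, A_comm e2 e1]
  simp

theorem ex_swap_right (x y z w : Q) : ex x y w z = (ex x y z w)⁻¹ :=
  (good_li y x).cm_swap (as_mem_right x y z) (as_mem_right x y w) (li_as x y z) (li_as x y w)

theorem ex_swap_mid (x y z w : Q) : ex x w z y = (ex x y z w)⁻¹ :=
  (good_ki x z).inv.cm_swap (as_mem_mid x y z) (as_mem_mid x w z) (ki_inv_as x y z)
    (ki_inv_as x w z)

theorem ex_swap_left (x y z w : Q) : ex w y z x = (ex x y z w)⁻¹ :=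
  (good_ri y z).inv.cm_swap (as_mem_left x y z) (as_mem_left w y z) (ri_inv_as x y z)
    (ri_inv_as w y z)

theorem ex_swap_last (x y z w : Q) : ex x z y w = (ex x y z w)⁻¹ := by
  rw [ex_swap_right x z w y, ex_swap_mid x y w z, ex_swap_right x y z w]; simp

/-! ### Nuclear and central elements -/

/-- Nuclear elements. -/
structure Nuc (n : Q) : Prop where
  left : ∀ x y : Q, n * x * y = n * (x * y)
  mid : ∀ x y : Q, x * n * y = x * (n * y)
  right : ∀ x y : Q, x * y * n = x * (y * n)

theorem nuc_of_fix {n : Q} (h1 : ∀ x y, li x y n = n) (h2 : ∀ x y, ki x y n = n)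
    (h3 : ∀ x y, ri x y n = n) : Nuc n :=
  ⟨fun x y => ri_fix.1 (h3 x y), fun x y => ki_fix.1 (h2 x y),
    fun x y => (li_fix.1 (h1 y x)).symm⟩

theorem Nuc.li {n : Q} (h : Nuc n) (x y : Q) : li x y n = n := li_fix.2 (h.right y x).symm

theorem Nuc.ki {n : Q} (h : Nuc n) (x y : Q) : ki x y n = n := ki_fix.2 (h.mid x y)

theorem Nuc.ri {n : Q} (h : Nuc n) (x y : Q) : ri x y n = n := ri_fix.2 (h.left x y)

theorem Nuc.mul {n m : Q} (hn : Nuc n) (hm : Nuc m) : Nuc (n * m) where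
  left x y := by simp only [hn.left, hm.left]
  mid x y := by rw [← hn.mid, hm.mid, hn.mid, hn.left]
  right x y := by rw [← hm.right, hn.right, hm.right, hm.right]

theorem Nuc.inv {n : Q} (hn : Nuc n) : Nuc n⁻¹ := by
  have e (x : Q) : x * n⁻¹ * n = x := by rw [hn.right, inv_mul_self', mul_one]
  refine ⟨fun x y => ?_, fun x y => ?_, fun x y => ?_⟩
  · rw [← mul_left_inj (x := n), ← hn.left, mul_inv_l, mul_inv_l]
  · obtain ⟨y, rfl⟩ : ∃ y', y = n * y' := ⟨n⁻¹ * y, by simp⟩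
    rw [← hn.mid, e, inv_mul_l]
  · rw [← mul_right_inj (x := n), e, hn.right, e]

/-- Central elements. -/
structure Cen (n : Q) : Prop extends Nuc n where
  comm : ∀ x : Q, n * x = x * n

theorem Cen.ti {n : Q} (h : Cen n) (x : Q) : ti x n = n := ti_fix.2 (h.comm x)

theorem Cen.mul {n m : Q} (hn : Cen n) (hm : Cen m) : Cen (n * m) :=
  ⟨hn.toNuc.mul hm.toNuc, fun x => by rw [hn.left, hm.comm, ← hn.left, hn.comm, hn.mid]⟩

theorem Cen.inv {n : Q} (hn : Cen n) : Cen n⁻¹ :=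
  ⟨hn.toNuc.inv, fun x => by
    rw [← mul_left_inj (x := n), mul_inv_l, ← hn.left, hn.comm x, hn.mid, mul_inv_self', mul_one]⟩

theorem as_nuc_mul {n : Q} (hn : Nuc n) (x y z : Q) : as (n * x) y z = as x y z := by
  have h := mul_assoc_as (n * x) y z
  rw [hn.left, hn.left, hn.left, hn.left, mul_left_inj, ← mul_assoc_as, mul_left_inj] at h
  exact h

theorem Good.fix_as {h : Perm Q} (hh : Good h) {p q t : Q} (ht : t ∈ S p) (hp : h p = p * t) :
    h (as q p p) = as q p p := by
  have hb : as q p p ∈ S p := as_mem_mid q p p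
  have hk : (ki q p)⁻¹ (p * t) = (ki q p)⁻¹ p * t := by
    rw [Perm.inv_eq_iff_eq, ki_mul_S ht]; simp
  have h1 : h (p * as q p p) = p * t * as q p p := by
    rw [← ki_inv_as, H_comm_apply hh.1 (inv_mem (ki_mem _ _)), hp, hk, ki_inv_as,
      A_assoc (A_self p) (S_le_A hb), A_comm (S_le_A hb) (S_le_A ht),
      ← A_assoc (A_self p) (S_le_A ht)]
  rw [hh.2 p _ hb, hp, mul_left_inj] at h1
  exact h1

theorem cen_as (q p : Q) : Cen (as q p p) where
  toNuc := nuc_of_fix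
    (fun x y => (good_li x y).fix_as (as_mem_right _ _ _) (li_as y x p))
    (fun x y => (good_ki x y).fix_as (S_inv (as_mem_mid x p y)) (ki_as x p y))
    (fun x y => by
      have := (good_ri x y).inv.fix_as (q := q) (as_mem_left p x y) (ri_inv_as p x y)
      rw [Perm.inv_eq_iff_eq] at this
      exact this.symm)
  comm x := ti_fix.1 ((good_ti x).fix_as (cm_mem_S_left p x) (mul_cm p x).symm)

theorem li_first (p q : Q) : li p q p = p * as q p p := li_as q p p

theorem li_first_inv (p q : Q) : li p q p⁻¹ = p⁻¹ * (as q p p)⁻¹ := by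
  rw [li_inv_of_mem (Or.inl (A_self p)), li_first]
  have ha := S_le_A (as_mem_mid q p p)
  rw [← mul_left_inj (x := p * as q p p), mul_inv_self',
    ← A_assoc (A_mul (A_self p) ha) (A_inv (A_self p)), A_comm (A_mul (A_self p) ha)
    (A_inv (A_self p)), inv_mul_l, mul_inv_self']

theorem li_flip (p q : Q) : li p q = li q⁻¹ (q * (p * q)) := by
  rw [li_def, li_def q⁻¹, lt_bol, ← lt_inv]
  have : q * (p * q) * q⁻¹ = q * p := by rw [← bol]; simp
  rw [this]; simp [mul_assoc]

theorem li_second_inv (p q : Q) :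
    li p q q⁻¹ = q⁻¹ * as (q * (p * q)) q⁻¹ q⁻¹ := by
  rw [li_flip, li_first]

theorem cp_eq (p q : Q) : ∃ n, Cen n ∧ cp p q = n * cm q⁻¹ p⁻¹ := by
  set b := as q p p with hb
  set b' := as (q * (p * q)) q⁻¹ q⁻¹ with hb'
  have cb : Cen b := cen_as q p
  have cb' : Cen b' := cen_as _ _
  set ε := cm q⁻¹ p⁻¹ with hε
  have hεq : ε ∈ S q := S_eq (A_eq_inv q) ▸ cm_mem_S_left q⁻¹ p⁻¹
  have hb'q : b' ∈ A q := A_eq_inv q ▸ S_le_A (as_mem_mid (q * (p * q)) q⁻¹ q⁻¹)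
  have hbp : b ∈ A p := S_le_A (as_mem_mid q p p)
  refine ⟨b * b'⁻¹, cb.mul cb'.inv, ?_⟩
  have hq : q⁻¹ * p⁻¹ = p⁻¹ * (q⁻¹ * ε) := (mul_mul_cm _ _).symm
  have h1 : li p q (p⁻¹ * b * (q⁻¹ * b'⁻¹ * ε)) = p⁻¹ * (q⁻¹ * ε) := by
    rw [li_mul_of_mem (Or.inl (A_mul (A_inv (A_self p)) hbp)),
      li_mul_of_mem' (Or.inl hbp), li_first_inv, ← hb, cb.li, li_mul_S_right hεq,
      li_mul_of_mem' (Or.inr (A_inv hb'q)), cb'.inv.li, li_second_inv, ← hb',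
      cb.inv.mid, inv_mul_self', mul_one, cb'.mid, mul_inv_self', mul_one]
  have h2 : cp p q = q * (p * (p⁻¹ * b * (q⁻¹ * b'⁻¹ * ε))) := by
    rw [← mul_li, h1, cp, hq]
  rw [h2, cb.mid, mul_inv_l, ← cb.mid, ← cb.comm, cb.left, cb'.inv.mid, mul_inv_l, cb.left]

/-! ### Commutators with associators vanish -/

theorem as_cm (x y w z : Q) : as (cm x y) w z = ex x w z y := by
  have h := (good_ri w z).inv.cm_left x y
  rw [ri_inv_as, ri_inv_as, cm_mul_S (as_mem_left x w z), mul_left_inj] at h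
  exact h.symm

theorem as_li_right (p q x w y : Q) (hx : A x = A q) :
    as x w (li p q y) = as x w y := by
  have h := H_comm_apply (li_mem p q) (li_mem w x) y
  rw [li_as x w y, li_as x w (li p q y), (good_li p q).2 _ _ (as_mem_right x w y),
    mul_left_inj] at h
  rw [← h]
  exact S_li_right (S_eq hx ▸ as_mem_left x w y) p

theorem ex_eq_sq (p q w y : Q) : ex q p w y = ex q⁻¹ w y p⁻¹ * ex q⁻¹ w y p⁻¹ := by
  set z := li p q y with hz
  obtain ⟨n, hn, hc⟩ := cp_eq p q
  set d := ex q⁻¹ w z p⁻¹ with hd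
  have hd' : d = ex q⁻¹ w y p⁻¹ := by
    rw [hd, ex, ex, as_li_right p q _ _ _ (A_eq_inv q)]
  have a1 : as (cp p q) w z = d := by rw [hc, as_nuc_mul hn.toNuc, as_cm]
  have a2 : as (cp p q) z w = d⁻¹ := by
    rw [hc, as_nuc_mul hn.toNuc, as_cm, ex_swap_last q⁻¹ w z p⁻¹]
  have d1 : d ∈ S w := a1 ▸ as_mem_mid (cp p q) w z
  have d2 : d ∈ S z := a1 ▸ as_mem_right (cp p q) w z
  have h1 : ti y w = ti z w * (d⁻¹ * d⁻¹) := by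
    rw [ti_li p q y w, ← hz, ki_as, a1, (good_li z (cp p q)).2 _ _ (S_inv d1),
      S_li_left (S_inv d2), li_as, a2, A_assoc (A_self w) (S_le_A (S_inv d1)),
      (good_ti z).2 _ _ (S_mul (S_inv d1) (S_inv d1)),
      ti_fix_A (A_self z) (S_le_A (S_mul (S_inv d2) (S_inv d2)))]
  have h2 : cm w y = cm w z * (d⁻¹ * d⁻¹) := by
    rw [← mul_cm, ← mul_cm w z, A_assoc (A_self w) (cm_mem_left w z), mul_left_inj] at h1
    exact h1
  have h3 : cm w z = cm w y * ex q p w y := by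
    rw [hz, (good_li p q).cm_right, ← (good_li p q).cm_left, li_as,
      cm_mul_S (as_mem_right q p w)]
    rfl
  have hE : ex q p w y ∈ A w := A_le (S_le_A (as_mem_right q p w)) (cm_mem_left _ y)
  have hd1 := S_le_A d1
  rw [h3, A_assoc (cm_mem_left w y) hE] at h2
  have h4 : cm w y * 1 = cm w y * (ex q p w y * (d⁻¹ * d⁻¹)) := by simpa using h2
  rw [mul_left_inj, A_comm hE (A_mul (A_inv hd1) (A_inv hd1)), A_assoc (A_inv hd1) (A_inv hd1)]
    at h4
  rw [← hd', ← mul_left_inj (x := d⁻¹), inv_mul_l, ← mul_left_inj (x := d⁻¹), ← h4]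
  simp

theorem cm_inv_left (y p : Q) : ∃ β, Cen β ∧ β ∈ A y ∧ cm y⁻¹ p = (cm y p)⁻¹ * β := by
  set y' := ti p y with hy'
  have hA : A y' = A y := A_eq_app (ti_mem p) y
  have h1 : li p y (ti p y⁻¹) = li y' p y'⁻¹ := by
    have e1 : p * ti p (y * y⁻¹) = p * (y' * ((li y' p)⁻¹ (li p y (ti p y⁻¹)))) := by
      rw [← mul_li y' p, show ∀ x, li y' p ((li y' p)⁻¹ x) = x by simp, mul_ti, hy', mul_ti p y,
        ki_fix.1 (ki_fix_A p (A_self y) (A_inv (A_self y))), ← mul_ti p y⁻¹, ← mul_li]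
    rw [mul_left_inj, mul_inv_self', H_one (ti_mem p)] at e1
    have e2 : y' * y'⁻¹ = y' * ((li y' p)⁻¹ (li p y (ti p y⁻¹))) := by rw [← e1]; simp
    rw [mul_left_inj] at e2
    rw [e2]; simp
  rw [H_comm_apply (li_mem p y) (ti_mem p), li_second_inv, li_first_inv] at h1
  set b1 := as p y' y' with hb1
  set b2 := as (y * (p * y)) y⁻¹ y⁻¹ with hb2
  have c1 : Cen b1 := cen_as p y'
  have c2 : Cen b2 := cen_as _ _
  have m1 : b1 ∈ A y := hA ▸ S_le_A (as_mem_mid p y' y')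
  have mS : b2 ∈ S y⁻¹ := as_mem_mid _ _ _
  have m2 : b2 ∈ A y := A_eq_inv y ▸ S_le_A mS
  have hc : cm y⁻¹ p ∈ A y := A_eq_inv y ▸ cm_mem_left y⁻¹ p
  have hd : cm y p ∈ A y := cm_mem_left y p
  rw [(good_ti p).2 _ _ mS, c2.ti, ← mul_cm, hy', ← mul_cm y p] at h1
  refine ⟨b1⁻¹ * b2⁻¹, c1.inv.mul c2.inv, A_mul (A_inv m1) (A_inv m2), ?_⟩
  have h2 := congrArg (· * b2⁻¹) h1
  simp only [c2.mid, c1.inv.mid, mul_inv_self', mul_one] at h2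
  rw [← mul_left_inj (x := y), mul_inv_l] at h2
  rw [h2, ← mul_left_inj (x := cm y p), ← A_assoc hd (A_self y), A_comm hd (A_self y)]
  simp only [mul_inv_l]

theorem Nuc.li_mul {n : Q} (hn : Nuc n) (p q z : Q) : AIMBol.li p q (z * n) =
    AIMBol.li p q z * n := by
  rw [← mul_left_inj (x := q * p), mul_li, ← hn.right p z, ← hn.right q, ← hn.right (q * p), mul_li]

theorem ex_inv_right (x w y p : Q) : ex x w y⁻¹ p = (ex x w y p)⁻¹ := by
  obtain ⟨β, hβ, hβy, e⟩ := cm_inv_left y p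
  have g := good_li w x
  have e1 : li w x (cm y⁻¹ p) = cm y⁻¹ p * ex x w y⁻¹ p := by
    rw [← g.cm_left, li_as, cm_mul_S (as_mem_right _ _ _), ex]
  have e2 : li w x (cm y p) = cm y p * ex x w y p := by
    rw [← g.cm_left, li_as, cm_mul_S (as_mem_right _ _ _), ex]
  have hd : cm y p ∈ A y := cm_mem_left y p
  have hex : ex x w y p ∈ A y := A_le (S_le_A (as_mem_right x w y)) (cm_mem_left _ p)
  rw [e, hβ.toNuc.li_mul, g.cm_inv, e2, hβ.mid, hβ.comm, ← hβ.right, mul_right_inj] at e1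
  have e3 := congrArg (fun t => cm y p * ex x w y p * t) e1
  simp only [mul_inv_self'] at e3
  rw [A_comm hd hex, A_assoc hex hd, mul_inv_l] at e3
  rw [← mul_left_inj (x := ex x w y p), ← e3, mul_inv_self']

theorem ex_inv_last (x w y p : Q) : ex x w y p⁻¹ = (ex x w y p)⁻¹ := by
  rw [ex_swap_right x w p⁻¹ y, ex_inv_right, ex_swap_right x w y p]; simp

theorem ex_inv_left (x w y p : Q) : ex x⁻¹ w y p = (ex x w y p)⁻¹ := by
  rw [ex_swap_left p w y x⁻¹, ex_inv_last, ex_swap_left x w y p]; simp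

theorem ex_eq_one (q p w y : Q) : ex q p w y = 1 := by
  have h := ex_eq_sq p q w y
  have e : ex q⁻¹ w y p⁻¹ = ex q p w y := by
    rw [ex_inv_left, ex_inv_last, ex_swap_mid q y w p, ex_swap_last q w y p, inv_inv']
  rw [e] at h
  have h' : ex q p w y * 1 = ex q p w y * ex q p w y := by rwa [mul_one]
  rw [mul_left_inj] at h'
  exact h'.symm

theorem cm_as (x y z w : Q) : cm (as x y z) w = 1 := ex_eq_one x y z w

theorem nuc_cm (x y : Q) : Nuc (cm x y) := by
  refine nuc_of_fix (fun p q => ?_) (fun p q => ?_) (fun p q => ?_)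
  · rw [← (good_li p q).cm_left, li_as, cm_mul_S (as_mem_right _ _ _)]
    rw [cm_as, mul_one]
  · symm
    rw [← Perm.inv_eq_iff_eq, ← (good_ki p q).inv.cm_left, ki_inv_as, cm_mul_S (as_mem_mid _ _ _)]
    rw [cm_as, mul_one]
  · symm
    rw [← Perm.inv_eq_iff_eq, ← (good_ri p q).inv.cm_left, ri_inv_as, cm_mul_S (as_mem_left _ _ _)]
    rw [cm_as, mul_one]

theorem nuc_cp (p q : Q) : Nuc (cp p q) := by
  obtain ⟨n, hn, h⟩ := cp_eq p q
  rw [h]; exact hn.toNuc.mul (nuc_cm _ _)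

theorem li_hom (p q y z : Q) : li p q (y * z) = li p q y * li p q z := by
  rw [li_mul_left]
  congr 1
  rw [Perm.inv_eq_iff_eq]
  exact (li_fix.2 ((nuc_cp p q).left _ _).symm).symm

/-! ### Congruence modulo the nucleus -/

theorem Nuc.ti {n : Q} (h : Nuc n) (x : Q) : Nuc (ti x n) := by
  rw [← mul_cm]; exact h.mul (nuc_cm n x)

/-- Congruence modulo the nucleus. -/
def Eqv (a b : Q) : Prop := ∃ n, Nuc n ∧ b = a * n

theorem nuc_one : Nuc (1 : Q) := ⟨by simp, by simp, by simp⟩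

theorem Eqv.refl (a : Q) : Eqv a a := ⟨1, nuc_one, (mul_one a).symm⟩

theorem Eqv.symm {a b : Q} (h : Eqv a b) : Eqv b a := by
  obtain ⟨n, hn, rfl⟩ := h
  exact ⟨n⁻¹, hn.inv, by rw [hn.mid, mul_inv_self', mul_one]⟩

theorem Eqv.trans {a b c : Q} (h : Eqv a b) (h' : Eqv b c) : Eqv a c := by
  obtain ⟨n, hn, rfl⟩ := h
  obtain ⟨m, hm, rfl⟩ := h'
  exact ⟨n * m, hn.mul hm, by rw [hn.mid]⟩

theorem Eqv.mul_left {a b : Q} (h : Eqv a b) (c : Q) : Eqv (c * a) (c * b) := by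
  obtain ⟨n, hn, rfl⟩ := h
  exact ⟨n, hn, (hn.right c a).symm⟩

theorem Eqv.mul_right {a b : Q} (h : Eqv a b) (c : Q) : Eqv (a * c) (b * c) := by
  obtain ⟨n, hn, rfl⟩ := h
  exact ⟨AIMBol.ti c n, hn.ti c, by rw [hn.mid, ← mul_ti c n, (hn.ti c).right]⟩

theorem Eqv.of_mul_left {a b c : Q} (h : Eqv (c * a) (c * b)) : Eqv a b := by
  obtain ⟨n, hn, h⟩ := h
  rw [hn.right, mul_left_inj] at h
  exact ⟨n, hn, h⟩

theorem Eqv.inv {a b : Q} (h : Eqv a b) : Eqv a⁻¹ b⁻¹ := by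
  obtain ⟨n, hn, rfl⟩ := h
  refine ⟨AIMBol.ti a⁻¹ n⁻¹, hn.inv.ti _, ?_⟩
  rw [mul_ti, ← mul_left_inj (x := a * n), mul_inv_self', hn.mid, ← hn.left, mul_inv_self',
    one_mul, mul_inv_self']

theorem eqv_comm (x y : Q) : Eqv (x * y) (y * x) :=
  ⟨cm y x, nuc_cm y x, by rw [(nuc_cm y x).right, mul_mul_cm]⟩

theorem mul_as_mul_S {x y z s : Q} (hs : s ∈ S z) :
    x * y * z * as x y z * s = x * y * z * (as x y z * s) := by
  have hr := as_mem_right x y z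
  have h : s ∈ S (z * as x y z) := by
    rw [← li_as, S_eq (A_eq_app (li_mem y x) z)]; exact hs
  rw [← S_mul_assoc_left hr, ← S_mul_assoc_left h, A_assoc (A_self z) (S_le_A hr),
    S_mul_assoc_left (S_mul hr hs)]

theorem as_swap_outer (x y z : Q) : Eqv (as z y x) (as x y z)⁻¹ := by
  have h1 : Eqv (x * y * z * as x y z) (z * y * x) := by
    rw [mul_assoc_as]
    exact ((eqv_comm y z).mul_left x).trans (eqv_comm _ _)
  have h2 : Eqv (z * y * x * as z y x) (x * y * z) := by
    rw [mul_assoc_as]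
    exact ((eqv_comm y x).mul_left z).trans (eqv_comm _ _)
  have h3 := (h1.mul_right (as z y x)).trans h2
  rw [mul_as_mul_S (as_mem_left z y x)] at h3
  have h4 : Eqv (x * y * z * (as x y z * as z y x)) (x * y * z * (as x y z * (as x y z)⁻¹)) := by
    simpa using h3
  exact h4.of_mul_left.of_mul_left

theorem as_inv_right (x y z : Q) : as x y z⁻¹ = (as x y z)⁻¹ := by
  have hr := S_le_A (as_mem_right x y z)
  have h : li y x (z * z⁻¹) = 1 := by simp
  have e : as x y z⁻¹ ∈ A z := A_eq_inv z ▸ S_le_A (as_mem_right x y z⁻¹)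
  rw [li_hom, li_as, li_as, A_comm (A_self z) hr, A_assoc hr (A_self z), mul_inv_l] at h
  rw [← mul_left_inj (x := as x y z), h, mul_inv_self']

theorem as_inv_left (x y z : Q) : Eqv (as x⁻¹ y z) (as x y z)⁻¹ := by
  have h := as_swap_outer z y x⁻¹
  rw [as_inv_right, inv_inv'] at h
  exact h.trans (as_swap_outer x y z)

theorem li_inv_inv (x y z : Q) : li x⁻¹ y⁻¹ (li y x z) = z := by
  have key (z : Q) : y⁻¹ * x⁻¹ * (li x⁻¹ y⁻¹ (x * y) * li x⁻¹ y⁻¹ (li y x z)) = z := by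
    rw [← li_hom, mul_li y x, mul_li]; simp
  have h1 := key 1
  have h : li x⁻¹ y⁻¹ (x * y) = (y⁻¹ * x⁻¹)⁻¹ := by
    rw [← mul_left_inj (x := y⁻¹ * x⁻¹), mul_inv_self', ← h1]; simp
  have h2 := key z
  rwa [h, mul_inv_l] at h2

theorem as_inv_inv (x y z : Q) : as y⁻¹ x⁻¹ z = (as x y z)⁻¹ := by
  have hr := S_le_A (as_mem_right x y z)
  have hs := S_le_A (as_mem_right y⁻¹ x⁻¹ z)
  have hx : as x y z ∈ S x⁻¹ := by rw [S_eq (A_eq_inv x)]; exact as_mem_left x y z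
  have h := li_inv_inv x y z
  rw [li_as x y, li_hom, S_li_left hx, li_as, A_assoc (A_self z) hs] at h
  have h' : z * (as y⁻¹ x⁻¹ z * as x y z) = z * 1 := by rw [h, mul_one]
  rw [mul_left_inj, A_comm hs hr] at h'
  rw [← mul_left_inj (x := as x y z), h', mul_inv_self']

theorem as_swap_left (x y z : Q) : Eqv (as y x z) (as x y z)⁻¹ := by
  have h := (as_inv_left y x z).inv
  have h1 := as_inv_left y x⁻¹⁻¹ z
  rw [as_inv_inv x⁻¹ y z] at h1
  simp only [inv_inv'] at h1 h
  have h2 := h1.inv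
  simp only [inv_inv'] at h2
  exact h2.symm.trans (as_inv_left x y z)

theorem nuc_as_cube (x y z : Q) : Nuc (as x y z * (as x y z * as x y z)) := by
  set r := as x y z with hr
  have h2 : Eqv (as y x z) r⁻¹ := as_swap_left x y z
  have h3 : Eqv (as y z x) r := by
    have := (as_swap_left z y x).trans (as_swap_outer x y z).inv
    simpa using this
  have e1 : Eqv (x * y * z * as y x z) (y * z * x * as y z x) := by
    have : Eqv (y * x * z * as y x z) (y * z * x * as y z x) := by
      rw [mul_assoc_as, mul_assoc_as]; exact (eqv_comm x z).mul_left y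
    exact (((eqv_comm x y).mul_right z).mul_right _).trans this
  have e2 : Eqv (y * z * x * as y z x) (x * y * z * (r * as y z x)) := by
    rw [hr, ← mul_as_mul_S (as_mem_mid y z x), mul_assoc_as x y z]
    exact (eqv_comm (y * z) x).mul_right _
  have e3 := h2.symm.trans ((e1.trans e2).of_mul_left.trans (h3.mul_left r))
  have e4 := e3.mul_left r
  rw [mul_inv_self'] at e4
  obtain ⟨n, hn, h⟩ := e4
  rw [h, one_mul]; exact hn

/-! ### Associators are nuclear -/

theorem li_as_app (p q x y z : Q) : li p q (li p q (as x y z)) = as x y z := by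
  set ψ := li p q with hψ
  have h1 (a b c : Q) : as a b (ψ c) = ψ (as a b c) := by
    have h := H_comm_apply (li_mem p q) (li_mem b a) c
    rw [li_as a b, li_as a b, li_hom, mul_left_inj] at h
    exact h.symm
  have h2 (a b c : Q) : as a (ψ b) c = ψ (as a b c) := by
    have h := H_comm_apply (li_mem p q) (inv_mem (ki_mem a c)) b
    rw [ki_inv_as, ki_inv_as, li_hom, mul_left_inj] at h
    exact h.symm
  have h3 (a b c : Q) : as (ψ a) b c = ψ (as a b c) := by
    have h := H_comm_apply (li_mem p q) (inv_mem (ri_mem b c)) a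
    rw [ri_inv_as, ri_inv_as, li_hom, mul_left_inj] at h
    exact h.symm
  have h4 : as (ψ x) (ψ y) (ψ z) = ψ (as x y z) := by
    have h := congrArg ψ (mul_assoc_as x y z)
    simp only [hψ, li_hom] at h
    rw [← mul_assoc_as, mul_left_inj] at h
    exact h.symm
  rw [h1, h2, h3] at h4
  exact ψ.injective h4

theorem li_as_fix (p q x y z : Q) : li p q (as x y z) = as x y z := by
  have h1 := li_as_app p q x y z
  have h2 := (nuc_as_cube x y z).li p q
  set r := as x y z with hr
  set d := as q p r with hd
  have dr : d ∈ A r := S_le_A (as_mem_right q p r)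
  have rr := A_self r
  rw [li_as q p r, li_hom, S_li_left (as_mem_mid q p r), li_as, ← hd, A_assoc rr dr] at h1
  have h1' : r * (d * d) = r * 1 := by rw [h1, mul_one]
  rw [mul_left_inj] at h1'
  have e : r * d * (r * d) = r * r := by
    rw [A_assoc rr dr, ← A_assoc dr rr, A_comm dr rr, A_assoc rr dr, h1', mul_one]
  rw [li_hom, li_hom, li_as, ← hd, e, A_assoc rr dr, mul_left_inj, A_comm dr (A_mul rr rr)] at h2
  have h3 : r * r * d = r * r * 1 := by rw [h2, mul_one]
  rw [mul_left_inj] at h3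
  rw [li_as, ← hd, h3, mul_one]

theorem Good.fix_as' {h : Perm Q} (hh : Good h) (x y z : Q) {t : Q} (ht : t ∈ A z)
    (hz : h z = z * t) (hl : li y x t = t) : h (as x y z) = as x y z := by
  have hr := as_mem_right x y z
  have h1 := H_comm_apply hh.1 (li_mem y x) z
  rw [li_as, hh.2 _ _ hr, hz, li_hom, hl, li_as, A_assoc (A_self z) (S_le_A hr),
    A_comm (S_le_A hr) ht, ← A_assoc (A_self z) ht, mul_left_inj] at h1
  exact h1

theorem li_inv_as (p q x y z : Q) : li p q (as x y z)⁻¹ = (as x y z)⁻¹ := by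
  rw [← as_inv_right, li_as_fix]

theorem nuc_as (x y z : Q) : Nuc (as x y z) := by
  refine nuc_of_fix (fun p q => li_as_fix p q x y z) (fun p q => ?_) (fun p q => ?_)
  · exact (good_ki p q).fix_as' x y z (A_inv (S_le_A (as_mem_mid p z q))) (ki_as p z q)
      (li_inv_as _ _ _ _ _)
  · have h := (good_ri p q).inv.fix_as' x y z (S_le_A (as_mem_left z p q)) (ri_inv_as z p q)
      (li_as_fix _ _ _ _ _)
    rw [Perm.inv_eq_iff_eq] at h
    exact h.symm

end AIMBol

namespace LoopStr

variable {Q : Type*} (L : LoopStr Q)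

theorem mul_left_cancel {x y z : Q} (h : L.mul x y = L.mul x z) : y = z := by
  rw [← L.ld_mul x y, h, L.ld_mul]

theorem mul_right_cancel {x y z : Q} (h : L.mul y x = L.mul z x) : y = z := by
  rw [← L.rd_mul y x, h, L.rd_mul]

/-- The right inverse of `x`. -/
def rinv (x : Q) : Q := L.ld x L.one

theorem ld_eq_of_bol
    (hBol : ∀ x y z, L.mul x (L.mul y (L.mul x z)) = L.mul (L.mul x (L.mul y x)) z) (x z : Q) :
    L.ld x z = L.mul (L.rinv x) z := by
  rw [rinv]
  have h1 : L.mul (L.ld x L.one) x = L.one := by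
    have h := hBol x (L.ld x L.one) (L.ld x L.one)
    rw [L.mul_ld, L.mul_one, L.mul_ld] at h
    have h2 : L.mul x (L.ld x L.one) =
        L.mul (L.mul x (L.mul (L.ld x L.one) x)) (L.ld x L.one) := by
      rw [L.mul_ld]; exact h
    have h3 := L.mul_right_cancel h2
    exact L.mul_left_cancel (x := x) (by rw [← h3, L.mul_one])
  have h := hBol x (L.ld x L.one) (L.ld x z)
  rw [h1, L.mul_one, L.mul_ld] at h
  exact L.mul_left_cancel (x := x) (by rw [h, L.mul_ld])

/-- The typeclass structure carried by an AIM left Bol loop. -/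
abbrev toAIMBol
    (hBol : ∀ x y z, L.mul x (L.mul y (L.mul x z)) = L.mul (L.mul x (L.mul y x)) z)
    (hAIM : L.IsAIM) : AIMBol Q :=
  have e := L.ld_eq_of_bol hBol
  { one := L.one
    mul := L.mul
    inv := L.rinv
    rdiv := L.rd
    one_mul := L.one_mul
    mul_one := L.mul_one
    inv_mul_l := fun x y => (e x _).symm.trans (L.ld_mul x y)
    mul_inv_l := fun x y => (congrArg (L.mul x) (e x y).symm).trans (L.mul_ld x y)
    rdiv_mul := L.rd_mul
    mul_rdiv := L.mul_rd
    bol := hBol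
    aim_TT := by
      have h := hAIM.1
      simp only [Tm, e] at h
      exact h
    aim_LL := by
      have h := hAIM.2.1
      simp only [Lm, e] at h
      exact h
    aim_RR := hAIM.2.2.1
    aim_TL := by
      have h := hAIM.2.2.2.1
      simp only [Tm, Lm, e] at h
      exact h
    aim_TR := by
      have h := hAIM.2.2.2.2.1
      simp only [Tm, Rm, e] at h
      exact h
    aim_LR := by
      have h := hAIM.2.2.2.2.2
      simp only [Lm, Rm, e] at h
      exact h }

theorem ld_self (x : Q) : L.ld x x = L.one :=
  L.mul_left_cancel (by rw [L.mul_ld, L.mul_one])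

theorem assoc_eq_one_of_inNucleus {a : Q} (h : L.inNucleus a) (u v : Q) :
    L.assoc a u v = L.one ∧ L.assoc u a v = L.one ∧ L.assoc u v a = L.one := by
  refine ⟨?_, ?_, ?_⟩
  · rw [assoc, h.1, ld_self]
  · rw [assoc, h.2.1, ld_self]
  · rw [assoc, h.2.2, ld_self]

end LoopStr

/-- In an AIM left Bol loop, associators and commutators lie in the nucleus,
and associators lie in the commutant. -/
theorem aim_left_bol_main {Q : Type*} (L : LoopStr Q)
    (hBol : ∀ x y z,
      L.mul x (L.mul y (L.mul x z)) = L.mul (L.mul x (L.mul y x)) z)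
    (hAIM : L.IsAIM) :
    (∀ x y z u v,
      L.assoc (L.assoc x y z) u v = L.one ∧
      L.assoc u (L.assoc x y z) v = L.one ∧
      L.assoc u v (L.assoc x y z) = L.one) ∧
    (∀ x y z u,
      L.assoc (L.comm x y) z u = L.one ∧
      L.assoc z (L.comm x y) u = L.one ∧
      L.assoc z u (L.comm x y) = L.one) ∧
    (∀ x y z u, L.comm (L.assoc x y z) u = L.one) := by
  let _ : AIMBol Q := L.toAIMBol hBol hAIM
  have hN {n : Q} (h : AIMBol.Nuc n) : L.inNucleus n := ⟨h.left, h.mid, h.right⟩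
  have ha (x y z : Q) : L.assoc x y z = (AIMBol.as x y z)⁻¹ := by
    refine L.mul_left_cancel ((L.mul_ld _ _).trans ?_)
    change x * y * z = x * (y * z) * (AIMBol.as x y z)⁻¹
    rw [← AIMBol.mul_assoc_as, (AIMBol.nuc_as x y z).mid, AIMBol.mul_inv_self', mul_one]
  have hc (x y : Q) : L.comm x y = AIMBol.cm x y := by
    refine L.mul_left_cancel ((L.mul_ld _ _).trans ?_)
    change x * y = y * x * AIMBol.cm x y
    rw [(AIMBol.nuc_cm x y).right, AIMBol.mul_mul_cm]
  refine ⟨fun x y z u v => ?_, fun x y z u => ?_, fun x y z u => ?_⟩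
  · rw [ha x y z]
    exact L.assoc_eq_one_of_inNucleus (hN (AIMBol.nuc_as x y z).inv) u v
  · rw [hc x y]
    exact L.assoc_eq_one_of_inNucleus (hN (AIMBol.nuc_cm x y)) z u
  · rw [ha, ← AIMBol.as_inv_right, hc]
    exact AIMBol.cm_as x y z⁻¹ u
end

section
/- Let Q be a C loop (a loop satisfying ((x·y)·y)·z = x·(y·(y·z)) for all x,y,z) which is an AIM loop. Then every associator and every commutator of Q lies in the nucleus N(Q), and every associator lies in the commutant; that is, for all x,y,z,u,v in Q: [[x,y,z],u,v] = [u,[x,y,z],v] = [u,v,[x,y,z]] = 1, [[x,y],z,u] = [z,[x,y],u] = [z,u,[x,y]] = 1, and [[x,y,z],u] = 1. (Equivalently, Q/N(Q) is an abelian group and Q/Z(Q) is a group.) -/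
/-- A Steiner loop: a commutative loop in which every left translation is an involution. -/
class SteinerLoop (S : Type*) extends MulOneClass S, CommMagma S where
  mul_mul_self_left : ∀ x y : S, x * (x * y) = y

namespace SteinerLoop

variable {S : Type*} [SteinerLoop S]

attribute [simp] mul_mul_self_left

@[simp] theorem mul_self (x : S) : x * x = 1 := by
  simpa using mul_mul_self_left x 1

@[simp] theorem mul_mul_self_right (x y : S) : y * x * x = y := by
  rw [mul_comm, mul_comm y, mul_mul_self_left]

@[simp] theorem mul_self_mul_right (x y : S) : x * (y * x) = y := by
  rw [mul_comm y, mul_mul_self_left]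

@[simp] theorem mul_self_mul_left (x y : S) : x * y * x = y := by
  rw [mul_comm, mul_mul_self_left]

theorem eq_mul_of_mul_eq {x y z : S} (h : x * y = z) : y = x * z := by
  rw [← h, mul_mul_self_left]

/-- The translation by `x`, as a permutation. -/
def tr (x : S) : Equiv.Perm S where
  toFun := (x * ·)
  invFun := (x * ·)
  left_inv := mul_mul_self_left x
  right_inv := mul_mul_self_left x

@[simp] theorem tr_apply (x y : S) : tr x y = x * y := rfl

@[simp] theorem tr_inv_apply (x y : S) : (tr x)⁻¹ y = x * y := rfl

variable (S) in
/-- The multiplication group. -/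
def mlt : Subgroup (Equiv.Perm S) := Subgroup.closure (Set.range tr)

variable (S) in
/-- The inner mapping group: the stabilizer of `1` in the multiplication group. -/
def inn : Subgroup (Equiv.Perm S) := mlt S ⊓ MulAction.stabilizer (Equiv.Perm S) (1 : S)

theorem tr_mem (x : S) : tr x ∈ mlt S := Subgroup.subset_closure ⟨x, rfl⟩

theorem map_one_of_mem {g : Equiv.Perm S} (hg : g ∈ inn S) : g 1 = 1 := hg.2

/-- The inner mapping `u ↦ (x * y) * (x * (y * u))`. -/
def lam (x y : S) : Equiv.Perm S := tr (x * y) * tr x * tr y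

@[simp] theorem lam_apply (x y u : S) : lam x y u = (x * y) * (x * (y * u)) := rfl

theorem lam_mem (x y : S) : lam x y ∈ inn S :=
  ⟨mul_mem (mul_mem (tr_mem _) (tr_mem _)) (tr_mem _), by simp⟩

theorem lam_apply_left (x y : S) : lam x y x = x := by simp

theorem lam_apply_right (x y : S) : lam x y y = y := by simp

theorem closure_le_inn :
    Subgroup.closure (Set.range fun p : S × S => lam p.1 p.2) ≤ inn S := by
  rw [Subgroup.closure_le]
  rintro _ ⟨p, rfl⟩
  exact lam_mem _ _

/-- Every inner mapping is a product of the mappings `lam x y`. -/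
theorem inn_le_closure :
    inn S ≤ Subgroup.closure (Set.range fun p : S × S => lam p.1 p.2) := by
  have key : ∀ g ∈ mlt S, ∃ x : S,
      ∃ h ∈ Subgroup.closure (Set.range fun p : S × S => lam p.1 p.2), g = tr x * h := by
    have step : ∀ y x : S, tr y * tr x = tr (y * x) * lam y x := by
      intro y x; ext t; simp
    intro g hg
    induction hg using Subgroup.closure_induction_left with
    | one => exact ⟨1, 1, one_mem _, by ext; simp⟩
    | mul_left _ hx g _ ih =>
      obtain ⟨y, rfl⟩ := hx
      obtain ⟨x, h, hh, rfl⟩ := ih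
      refine ⟨y * x, lam y x * h, mul_mem (Subgroup.subset_closure ⟨(y, x), rfl⟩) hh, ?_⟩
      rw [← mul_assoc, step, mul_assoc]
    | inv_mul_cancel _ hx g _ ih =>
      obtain ⟨y, rfl⟩ := hx
      obtain ⟨x, h, hh, rfl⟩ := ih
      refine ⟨y * x, lam y x * h, mul_mem (Subgroup.subset_closure ⟨(y, x), rfl⟩) hh, ?_⟩
      have : (tr y)⁻¹ = tr y := by ext; simp
      rw [this, ← mul_assoc, step, mul_assoc]
  intro g hg
  obtain ⟨x, h, hh, rfl⟩ := key g hg.1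
  have h1 : h 1 = 1 := by
    exact (closure_le_inn hh).2
  have hx : x = 1 := by simpa [h1] using hg.2
  have : tr (1 : S) = 1 := by ext; simp
  rwa [hx, this, one_mul]

end SteinerLoop

/-- A Steiner loop with commuting inner mappings. -/
class SteinerAIMLoop (S : Type*) extends SteinerLoop S where
  lam_comm : ∀ x y z w u : S,
    SteinerLoop.lam x y (SteinerLoop.lam z w u) = SteinerLoop.lam z w (SteinerLoop.lam x y u)

namespace SteinerAIMLoop

open SteinerLoop

variable {S : Type*} [SteinerAIMLoop S] {φ ψ θ : Equiv.Perm S}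

theorem inn_comm (hφ : φ ∈ inn S) (hψ : ψ ∈ inn S) (x : S) : φ (ψ x) = ψ (φ x) := by
  have hc : ∀ a ∈ Set.range (fun p : S × S => lam p.1 p.2),
      ∀ b ∈ Set.range (fun p : S × S => lam p.1 p.2), a * b = b * a := by
    rintro _ ⟨p, rfl⟩ _ ⟨q, rfl⟩
    ext u
    exact lam_comm _ _ _ _ _
  have := Subgroup.le_centralizer_iff_isMulCommutative.2 (Subgroup.isMulCommutative_closure hc)
  have h := Subgroup.mem_centralizer_iff.1 (this (inn_le_closure hφ)) ψ (inn_le_closure hψ)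
  exact (congrArg (fun g : Equiv.Perm S => g x) h).symm

/-- The stabilizer of `u` in the inner mapping group commutes with translation by `u * φ u`. -/
theorem map_mul_of_fix (hθ : θ ∈ inn S) (hφ : φ ∈ inn S) {u : S} (hu : θ u = u) (r : S) :
    θ (u * φ u * r) = u * φ u * θ r := by
  have h1 : tr u * θ * tr u ∈ inn S :=
    ⟨mul_mem (mul_mem (tr_mem _) hθ.1) (tr_mem _), by simp [hu]⟩
  have h2 : tr (u * φ u) * tr u * φ * tr u ∈ inn S :=
    ⟨mul_mem (mul_mem (mul_mem (tr_mem _) (tr_mem _)) hφ.1) (tr_mem _), by simp⟩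
  have e1 : ∀ t, θ (u * φ (u * t)) = u * φ (u * θ t) := by
    intro t
    have := inn_comm h1 hφ (u * t)
    simp at this
    rw [← this]; simp
  have e2 : ∀ t, θ (u * φ u * (u * φ (u * t))) = u * φ u * (u * φ (u * θ t)) := by
    intro t
    simpa using inn_comm hθ h2 t
  have e3 := e2 (u * φ.symm (u * r))
  rw [← e1] at e3
  simpa using e3

theorem map_mul_self_of_fix (hθ : θ ∈ inn S) (hφ : φ ∈ inn S) {u : S} (hu : θ u = u) :
    θ (u * φ u) = u * φ u := by
  simpa [map_one_of_mem hθ] using map_mul_of_fix hθ hφ hu 1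

theorem fix_map (hθ : θ ∈ inn S) (hφ : φ ∈ inn S) {u : S} (hu : θ u = u) :
    θ (φ u) = φ u := by
  rw [inn_comm hθ hφ, hu]

theorem fix_of_fix_map (hθ : θ ∈ inn S) (hφ : φ ∈ inn S) {u : S} (hu : θ (φ u) = φ u) :
    θ u = u := by
  rw [inn_comm hθ hφ] at hu
  exact φ.injective hu

theorem map_mul_eq (hφ : φ ∈ inn S) (u t : S) : φ u * t = u * (u * φ u * t) := by
  have h : (t * φ u) * (t * (φ u * u)) = u := by
    simpa using fix_of_fix_map (lam_mem t (φ u)) hφ (u := u) (by simp)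
  have h2 := eq_mul_of_mul_eq (eq_mul_of_mul_eq h).symm
  rw [mul_comm (φ u) u] at h2
  have h4 : u * φ u * t = u * (φ u * t) := by
    rw [mul_comm _ t, mul_comm u (φ u), eq_mul_of_mul_eq h, mul_comm (t * φ u) u, mul_comm t]
  rw [h4, mul_mul_self_left]

theorem map_mul_eq' (hφ : φ ∈ inn S) (u t : S) : φ u * t = u * φ u * (u * t) := by
  have h := map_mul_eq hφ u (φ u * t)
  rw [mul_mul_self_left] at h
  rw [eq_mul_of_mul_eq (eq_mul_of_mul_eq h.symm)]

theorem mul_left_comm_self (hφ : φ ∈ inn S) (u t : S) :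
    u * φ u * (u * t) = u * (u * φ u * t) := by
  rw [← map_mul_eq' hφ, map_mul_eq hφ]

/-- The product `x * φ x` does not change when both factors are multiplied by `m`. -/
theorem mul_mul_mul_map (hφ : φ ∈ inn S) (m x : S) :
    (m * x) * (m * φ x) = x * φ x := by
  have h : tr (m * x) * tr m * tr x ∈ inn S :=
    ⟨mul_mem (mul_mem (tr_mem _) (tr_mem _)) (tr_mem _), by simp⟩
  have := map_mul_self_of_fix h hφ (u := x) (by simp)
  simpa using this

theorem lam_lam (y z x : S) : lam y z (lam y z x) = x := by
  have m1 : tr z * tr (y * z) * tr y ∈ inn S :=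
    ⟨mul_mem (mul_mem (tr_mem _) (tr_mem _)) (tr_mem _), by simp [mul_comm y z]⟩
  have m2 : tr y * tr z * tr (y * z) ∈ inn S :=
    ⟨mul_mem (mul_mem (tr_mem _) (tr_mem _)) (tr_mem _), by simp⟩
  have e0 := mul_mul_mul_map (lam_mem y z) z x
  have e1 := mul_mul_mul_map m1 y (z * x)
  have e2 := mul_mul_mul_map m2 (y * z) (y * (z * x))
  simp at e0 e1 e2
  rw [e1, e0] at e2
  have e3 := eq_mul_of_mul_eq e2
  rw [lam_apply, lam_apply, e3]; simp

theorem inn_inn (hφ : φ ∈ inn S) (x : S) : φ (φ x) = x := by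
  have h := inn_le_closure hφ
  have hle := closure_le_inn (S := S)
  clear hφ
  induction h using Subgroup.closure_induction generalizing x with
  | mem g hg => obtain ⟨p, rfl⟩ := hg; exact lam_lam _ _ _
  | one => rfl
  | mul g k hg hk ihg ihk =>
    simp only [Equiv.Perm.mul_apply]
    rw [inn_comm (hle hk) (hle hg), ihg, ihk]
  | inv g _ ih => rw [Equiv.Perm.inv_eq_iff_eq, Equiv.Perm.inv_eq_iff_eq, ih]

/-- The associator of a Steiner loop. -/
def asc (u v w : S) : S := (u * (v * w)) * (u * v * w)

theorem asc_eq (u v w : S) : asc u v w = w * lam u v w := by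
  rw [← mul_mul_mul_map (lam_mem u v) (u * v) w]
  simp [asc, mul_comm]

theorem asc_comm (u v w : S) : asc u v w = asc w v u := by
  simp only [asc]
  rw [mul_comm (u * (v * w)), mul_comm (u * v), mul_comm u (v * w), mul_comm u v, mul_comm v w]

theorem mul_lam_comm (u v w : S) : w * lam u v w = u * lam w v u := by
  rw [← asc_eq, ← asc_eq, asc_comm]

/-- The deviation of `φ` from fixing products with left factor `x`. -/
def chi (φ : Equiv.Perm S) (x : S) : Equiv.Perm S := tr (φ x) * φ * tr x * φ

theorem chi_apply (x t : S) : chi φ x t = φ x * φ (x * φ t) := rfl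

theorem chi_mem (hφ : φ ∈ inn S) (x : S) : chi φ x ∈ inn S :=
  ⟨mul_mem (mul_mem (mul_mem (tr_mem _) hφ.1) (tr_mem _)) hφ.1, by
    simp [chi_apply, map_one_of_mem hφ]⟩

theorem mul_map_mul (hφ : φ ∈ inn S) (x t : S) :
    x * φ (x * t) = x * φ x * chi φ x (φ t) := by
  rw [chi_apply, inn_inn hφ, map_mul_eq' hφ, mul_mul_self_left]

theorem chi_apply_self_of {x : S} (h : φ (x * φ x) = x * φ x) :
    chi φ x x = x := by
  rw [chi_apply, h, mul_self_mul_right]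

theorem map_mul_of_map_mul_self (hφ : φ ∈ inn S) {x : S} (h : φ (x * φ x) = x * φ x) (r : S) :
    φ (x * φ x * r) = x * φ x * φ r := by
  have hχ := chi_mem hφ x
  have hx := chi_apply_self_of h
  have e1 : ∀ t, φ (x * φ x * chi φ x (φ t)) = chi φ x (x * φ x * t) := by
    intro t
    have h1 := mul_map_mul hφ x (φ (chi φ x (x * φ x * t)))
    rw [inn_inn hφ, inn_inn hχ, mul_mul_self_left] at h1
    rw [← mul_map_mul hφ, ← eq_mul_of_mul_eq h1, inn_inn hφ, mul_mul_self_left, inn_inn hφ]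
  have := e1 (φ (chi φ x r))
  rw [inn_inn hφ, inn_inn hχ, map_mul_of_fix hχ hφ hx, inn_comm hχ hφ, inn_inn hχ] at this
  exact this

theorem mul_map_map_of (hφ : φ ∈ inn S) (hψ : ψ ∈ inn S) {x : S}
    (h : φ (x * φ x) = x * φ x) : x * φ (ψ x) = x * φ x * φ (x * ψ x) := by
  have h' := mul_map_mul hφ x (x * ψ x)
  rw [mul_mul_self_left] at h'
  rw [h', inn_comm (chi_mem hφ x) hφ, map_mul_self_of_fix (chi_mem hφ x) hψ
    (chi_apply_self_of h)]

theorem map_mul_self (hφ : φ ∈ inn S) (x : S) : φ (x * φ x) = x * φ x := by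
  have h := inn_le_closure hφ
  have hle := closure_le_inn (S := S)
  clear hφ
  induction h using Subgroup.closure_induction with
  | mem g hg =>
    obtain ⟨p, rfl⟩ := hg
    rw [mul_lam_comm]
    exact map_mul_self_of_fix (lam_mem _ _) (lam_mem _ _) (lam_apply_left _ _)
  | one => rfl
  | mul g k hg hk ihg ihk =>
    have hg := hle hg
    have hk := hle hk
    simp only [Equiv.Perm.mul_apply]
    have h1 := mul_map_map_of hg hk ihg
    have h2 := mul_map_map_of hk hg ihk
    rw [inn_comm hk hg, h1] at h2
    rw [h1, inn_comm hg hk, map_mul_of_map_mul_self hg ihg, inn_inn hg, mul_comm (x * g x),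
      map_mul_of_map_mul_self hk ihk, h2]
  | inv g hg ih =>
    have : g⁻¹ = g := by
      ext t; rw [Equiv.Perm.inv_eq_iff_eq, inn_inn (hle hg)]
    rwa [this]

theorem map_mul_dev (hφ : φ ∈ inn S) (x r : S) : φ (x * φ x * r) = x * φ x * φ r :=
  map_mul_of_map_mul_self hφ (map_mul_self hφ x) r

theorem chi_apply_self (hφ : φ ∈ inn S) (x : S) : chi φ x x = x :=
  chi_apply_self_of (map_mul_self hφ x)

theorem map_mul (hφ : φ ∈ inn S) (x t : S) : φ (x * t) = x * (x * φ x * chi φ x (φ t)) := by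
  rw [← mul_map_mul hφ, mul_mul_self_left]

theorem chi_mul (hφ : φ ∈ inn S) (x t : S) : chi φ x (x * t) = x * chi φ x t := by
  have hχ := chi_mem hφ x
  have h1 : ∀ t, φ (x * φ t) = x * (x * φ x * chi φ x t) := fun t => by
    rw [map_mul hφ, inn_inn hφ]
  have h2 := h1 (φ (x * φ t))
  rw [inn_inn hφ, mul_mul_self_left, inn_inn hφ, h1] at h2
  rw [← map_mul_of_fix hχ hφ (chi_apply_self hφ x) (x * (x * φ x * chi φ x t)),
    ← mul_left_comm_self hφ, mul_mul_self_left] at h2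
  conv_lhs => rw [h2, mul_mul_self_left, inn_inn hχ]

/-- The operations `x ↦ x * φ x` and `x ↦ x * ψ x` commute. -/
theorem dev_comm (hφ : φ ∈ inn S) (hψ : ψ ∈ inn S) (x : S) :
    x * ψ x * φ (x * ψ x) = x * φ x * ψ (x * φ x) := by
  have hχ := chi_mem hφ x
  have hχ' := chi_mem hψ x
  have e1 : ψ (x * φ (x * ψ (x * φ x))) = x * φ x * ψ (x * φ x) := by
    rw [mul_map_mul hφ, inn_comm hφ hψ, map_mul_self hφ,
      inn_comm hχ hψ, map_mul_self_of_fix hχ hφ (chi_apply_self hφ x), map_mul_self hψ]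
  have e2 : φ (x * ψ (x * φ x)) = chi ψ x (ψ (x * φ (x * ψ x))) := by
    have e3 : φ (x * ψ x * φ x) = x * φ (x * ψ x) := by
      rw [mul_comm _ (φ x), map_mul_eq hφ, mul_comm (x * φ x), map_mul hφ,
        mul_comm (x * ψ x), map_mul_dev hφ, map_mul_of_fix hχ hφ (chi_apply_self hφ x),
        fix_map hχ hφ (map_mul_self_of_fix hχ hψ (chi_apply_self hφ x)), mul_mul_self_left]
    rw [mul_map_mul hψ, ← map_mul_of_fix hχ' hψ (chi_apply_self hψ x), ← map_mul_dev hψ,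
      inn_comm hφ hχ', inn_comm hφ hψ, e3]
  have e4 : ψ (x * φ (x * ψ (x * φ x))) = x * ψ x * φ (x * ψ x) := by
    have h := mul_map_mul hψ x (φ (x * ψ (x * φ x)))
    have h5 : chi ψ x (ψ (φ (x * ψ (x * φ x)))) = x * φ (x * ψ x) := by
      rw [e2, inn_comm hψ hχ', inn_inn hχ', inn_inn hψ]
    rw [h5, mul_left_comm_self hψ] at h
    exact (mul_mul_self_left x _).symm.trans ((congrArg (x * ·) h).trans (mul_mul_self_left x _))
  rw [← e4, e1]

theorem map_mul_dev_of_commute (hφ : φ ∈ inn S) (hθ : θ ∈ inn S) {y : S}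
    (h : ∀ r, θ (y * φ y * r) = y * φ y * θ r) (t : S) :
    φ (y * θ y * t) = y * θ y * φ t := by
  have hχ := chi_mem hφ y
  have hχθ := chi_mem hθ y
  have e1 : ∀ t, φ (y * t) = y * φ y * (y * chi φ y (φ t)) := fun t => by
    rw [map_mul hφ, mul_left_comm_self hφ]
  have e2 : ∀ t, y * θ y * t = y * θ (y * chi θ y (θ t)) := fun t => by
    rw [mul_map_mul hθ, inn_comm hθ hχθ, inn_inn hχθ, inn_inn hθ]
  rw [e2, e1, inn_comm hφ hθ, e1, h, map_mul_of_fix hχ hφ (chi_apply_self hφ y),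
    ← mul_left_comm_self hφ, mul_mul_self_left, inn_comm hχ hθ, chi_mul hφ, inn_inn hχ, e2,
    inn_comm hφ hχθ, inn_comm hφ hθ]

theorem mul_map_mul_eq (hψ : ψ ∈ inn S) (c x : S) :
    c * x * ψ (c * x) = c * ψ c * (ψ x * chi ψ c (ψ x) * (x * ψ x)) := by
  have hχ := chi_mem hψ c
  generalize hb : ψ x * chi ψ c (ψ x) = b
  have fixb : ∀ θ ∈ inn S, θ x = x → ∀ t, θ (b * t) = b * θ t := fun θ hθ hx t => by
    rw [← hb, map_mul_of_fix hθ hχ (fix_map hθ hψ hx)]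
  have m1 : tr (c * ψ c) * tr x * tr (c * ψ c) * tr x ∈ inn S :=
    ⟨mul_mem (mul_mem (mul_mem (tr_mem _) (tr_mem _)) (tr_mem _)) (tr_mem _), by simp⟩
  have m2 : tr b * tr x * tr b * tr x ∈ inn S :=
    ⟨mul_mem (mul_mem (mul_mem (tr_mem _) (tr_mem _)) (tr_mem _)) (tr_mem _), by simp⟩
  have m3 : tr (c * x) * tr c * tr x ∈ inn S :=
    ⟨mul_mem (mul_mem (tr_mem _) (tr_mem _)) (tr_mem _), by simp⟩
  have f1 := map_mul_self_of_fix m1 hψ (u := x) (by simp)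
  have f2 := map_mul_self_of_fix m2 hψ (u := x) (by simp)
  have f3 := map_mul_self_of_fix m3 hψ (u := c * x) (by simp)
  have g1 := fixb _ m1 (by simp) (x * ψ x)
  rw [f1] at g1
  simp only [Equiv.Perm.mul_apply, tr_apply] at g1 f2 f3
  have e1 : x * (c * ψ c * (x * (b * (x * ψ x)))) = c * ψ c * (b * (x * ψ x)) :=
    eq_mul_of_mul_eq g1
  have e2 : b * (x * ψ x * x) = x * (b * (x * ψ x)) := by
    rw [mul_comm _ x]
    exact eq_mul_of_mul_eq (eq_mul_of_mul_eq f2)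
  have e3 : c * x * ψ (c * x) = c * x * (c * (c * ψ c * (b * (x * ψ x * x)))) := by
    rw [map_mul hψ, ← hb]
    simp
  refine ((tr (c * x) * tr c * tr x).injective ?_).symm
  simp only [Equiv.Perm.mul_apply, tr_apply]
  rw [f3, e3, ← e1, e2, mul_mul_self_left]

theorem dev_mul_dev (hψ : ψ ∈ inn S) (c d x : S) :
    c * x * ψ (c * x) * lam c d (c * x * ψ (c * x)) = x * ψ x * lam c d (x * ψ x) := by
  have hφ := lam_mem c d
  have hφc : lam c d c = c := lam_apply_left c d
  have hχ := chi_mem hψ c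
  have hχc := chi_apply_self hψ c
  have hf := mul_lam_comm c d (ψ x)
  have he : x * ψ x * lam c d (x * ψ x) =
      c * ψ c * lam x d (c * ψ c) := by
    rw [dev_comm hφ hψ, mul_lam_comm, dev_comm hψ (lam_mem x d)]
  have hb : ∀ r, lam c d (ψ x * chi ψ c (ψ x) * r) = ψ x * chi ψ c (ψ x) * lam c d r :=
    map_mul_dev_of_commute hφ hχ fun r => by
      rw [hf, map_mul_of_fix hχ (lam_mem _ _) hχc]
  rw [mul_map_mul_eq hψ, map_mul_of_fix hφ hψ hφc, hb]
  generalize ψ x * chi ψ c (ψ x) = b at *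
  have e1 : lam b (x * ψ x) (x * ψ x * lam c d (x * ψ x)) = x * ψ x * lam c d (x * ψ x) :=
    map_mul_self_of_fix (lam_mem _ _) hφ (lam_apply_right _ _)
  have e2 : lam (c * ψ c) (b * (x * ψ x)) (x * ψ x * lam c d (x * ψ x)) =
      x * ψ x * lam c d (x * ψ x) := by
    rw [he]
    exact map_mul_self_of_fix (lam_mem _ _) (lam_mem _ _) (lam_apply_left _ _)
  rw [lam_apply] at e1 e2
  rw [mul_mul_self_left] at e1
  rw [← eq_mul_of_mul_eq e1] at e2
  exact e2

theorem lam_apply_inv (x y u : S) : lam x y u = y * (x * (x * y * u)) := by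
  apply (lam x y).injective
  rw [lam_lam]; simp

theorem lam_dev_comm (hψ : ψ ∈ inn S) (v w x : S) :
    lam v w (x * ψ x) = lam w v (x * ψ x) := by
  have key : ∀ c d, lam d (c * d) (x * ψ x) = lam (c * d) d (x * ψ x) := by
    intro c d
    have hγ : tr c * lam c d * tr c ∈ inn S :=
      ⟨mul_mem (mul_mem (tr_mem _) (lam_mem c d).1) (tr_mem _), by simp⟩
    have h1 := dev_mul_dev hψ c d x
    have h2 := mul_mul_mul_map hγ c x
    simp only [Equiv.Perm.mul_apply, tr_apply, mul_mul_self_left] at h2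
    have h3 := dev_comm hγ hψ x
    simp only [Equiv.Perm.mul_apply, tr_apply] at h3
    rw [dev_comm (lam_mem c d) hψ, h2, ← h3] at h1
    have h4 := (tr (x * ψ x)).injective h1
    have h5 : c * lam c d (c * (x * ψ x)) =
        lam (c * d) d (lam c d (lam d c (x * ψ x))) := by
      rw [lam_apply_inv c d (lam d c _)]
      simp [mul_comm d c]
    rw [h5, inn_comm (lam_mem _ _) (lam_mem c d)] at h4
    have h6 := congrArg (lam (c * d) d) ((lam c d).injective h4)
    rw [lam_lam] at h6
    rw [← h6, lam_apply_inv d c]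
    simp [mul_comm d c]
  simpa using key (w * v) v

/-- Inner mappings fix all associators. -/
theorem map_asc (hψ : ψ ∈ inn S) (u v w : S) : ψ (asc u v w) = asc u v w := by
  have m1 : tr u * tr w * tr u * tr w ∈ inn S :=
    ⟨mul_mem (mul_mem (mul_mem (tr_mem _) (tr_mem _)) (tr_mem _)) (tr_mem _), by simp⟩
  have m2 : tr w * tr u * tr w * tr u ∈ inn S :=
    ⟨mul_mem (mul_mem (mul_mem (tr_mem _) (tr_mem _)) (tr_mem _)) (tr_mem _), by simp⟩
  have h1 := mul_mul_mul_map m2 w v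
  have h2 := mul_mul_mul_map m1 u (w * v)
  have h3 := dev_comm m2 hψ v
  simp only [Equiv.Perm.mul_apply, tr_apply, mul_mul_self_left] at h1 h2 h3
  have h4 : w * (u * (w * (u * (v * ψ v)))) = v * ψ v := by
    have h : lam u w (lam w u (v * ψ v)) = v * ψ v := by rw [lam_dev_comm hψ w u, lam_lam]
    rwa [lam_apply_inv u w, lam_apply w u, mul_comm u w, mul_mul_self_left] at h
  rw [h4, mul_self] at h3
  rw [asc, mul_comm v w, mul_comm (u * v), h2, h1]
  exact (eq_mul_of_mul_eq h3.symm).trans (mul_one _)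

theorem left_comm_of_fixed {c : S} (hc : ∀ φ ∈ inn S, φ c = c) (x y : S) :
    x * (c * y) = c * (x * y) := by
  have h := hc _ (lam_mem x y)
  rw [lam_apply] at h
  rw [mul_comm c, mul_comm c]
  exact eq_mul_of_mul_eq h

theorem map_mul_of_fixed {c : S} (hc : ∀ φ ∈ inn S, φ c = c) (hφ : φ ∈ inn S) (t : S) :
    φ (c * t) = c * φ t := by
  have h := inn_le_closure hφ
  clear hφ
  induction h using Subgroup.closure_induction generalizing t with
  | mem g hg =>
    obtain ⟨p, rfl⟩ := hg
    simp only [lam_apply]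
    rw [left_comm_of_fixed hc, left_comm_of_fixed hc, left_comm_of_fixed hc]
  | one => rfl
  | mul g k _ _ ihg ihk => simp only [Equiv.Perm.mul_apply, ihg, ihk]
  | inv g _ ih => rw [Equiv.Perm.inv_eq_iff_eq, ih]; simp

theorem map_dev (hψ : ψ ∈ inn S) (hφ : φ ∈ inn S) (x : S) : ψ (x * φ x) = x * φ x := by
  have h := inn_le_closure hφ
  have hle := closure_le_inn (S := S)
  clear hφ
  induction h using Subgroup.closure_induction generalizing ψ with
  | mem g hg =>
    obtain ⟨p, rfl⟩ := hg
    rw [← asc_eq, map_asc hψ]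
  | one => simp [map_one_of_mem hψ]
  | mul g k hg hk ihg ihk =>
    have hg := hle hg
    simp only [Equiv.Perm.mul_apply]
    rw [mul_map_map_of hg (hle hk) (ihg hg), ihk hg, mul_comm (x * g x),
      map_mul_of_fixed (fun θ hθ => ihk hθ) hψ, ihg hψ]
  | inv g hg ih =>
    have : g⁻¹ = g := by
      ext t; rw [Equiv.Perm.inv_eq_iff_eq, inn_inn (hle hg)]
    rw [this]
    exact ih hψ

theorem chi_eq_of_fixed {c : S} (hc : ∀ φ ∈ inn S, φ c = c) (hφ : φ ∈ inn S) (t : S) :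
    chi φ c t = t := by
  rw [chi_apply, map_mul_of_fixed hc hφ, hc φ hφ, inn_inn hφ, mul_mul_self_left]

theorem asc_fixed (u v w : S) : ∀ φ ∈ inn S, φ (asc u v w) = asc u v w :=
  fun _ hφ => map_asc hφ u v w

theorem asc_mul_of_fixed {c : S} (hc : ∀ φ ∈ inn S, φ c = c) (u v w : S) :
    asc u v (c * w) = asc u v w := by
  rw [asc_eq, asc_eq, map_mul_of_fixed hc (lam_mem _ _), left_comm_of_fixed hc (c * w),
    mul_comm (c * w), left_comm_of_fixed hc, mul_mul_self_left, mul_comm]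

theorem asc_mul_asc (u v w : S) : asc u v w * asc u w v = asc v u w := by
  have hZ : v * (u * w) = asc u w v * (u * (v * w)) := by
    rw [asc, mul_comm w v, mul_self_mul_left, mul_comm v]
  have h : asc u v w = v * u * w * (u * (v * w)) := by rw [asc, mul_comm, mul_comm v u]
  rw [asc.eq_1 v, hZ, mul_comm _ (v * u * w), left_comm_of_fixed (asc_fixed _ _ _), ← h, mul_comm]

theorem asc_mul_mul (u v w : S) : asc (u * v) v (v * w) = asc u v w := by
  rw [asc, asc, mul_comm]; simp

theorem asc_mul_left (u v w : S) : asc u (u * v) w = asc u v w := by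
  rw [asc_eq, asc_eq, lam_apply_inv u v]; simp

theorem asc_mul_mul_mul (u v w : S) : asc v (u * v) (v * w) = asc u v (u * w) := by
  have h : u * v * (v * w) = asc (u * v) v w * (u * w) := by
    rw [asc, mul_mul_self_right, mul_mul_self_right]
  rw [← asc_mul_mul v, mul_self_mul_right, asc_mul_left, h, asc_mul_of_fixed (asc_fixed _ _ _)]

theorem asc_eq_mul_asc (u v w : S) :
    asc u v w = asc (u * w) v u * asc (u * w) v w := by
  rw [← asc_mul_mul, ← asc_mul_asc, asc_mul_mul_mul, mul_comm v w, mul_comm u v,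
    asc_mul_mul_mul, asc_comm u, asc_comm w, mul_comm w u]

end SteinerAIMLoop

/-- A C loop, presented with its two-sided inverses. -/
class CLoop (Q : Type*) extends MulOneClass Q, Inv Q where
  inv_mul_mul : ∀ x y : Q, x⁻¹ * (x * y) = y
  mul_inv_mul : ∀ x y : Q, x * (x⁻¹ * y) = y
  mul_mul_inv : ∀ x y : Q, y * x * x⁻¹ = y
  mul_inv_mul_self : ∀ x y : Q, y * x⁻¹ * x = y
  c_law : ∀ x y z : Q, x * y * y * z = x * (y * (y * z))

namespace CLoop

attribute [simp] inv_mul_mul mul_inv_mul mul_mul_inv mul_inv_mul_self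

variable {Q : Type*} [CLoop Q]

@[simp] theorem inv_mul_self (x : Q) : x⁻¹ * x = 1 := by simpa using inv_mul_mul x 1

@[simp] theorem mul_inv_self (x : Q) : x * x⁻¹ = 1 := by simpa using mul_inv_mul x 1

theorem left_cancel {x y z : Q} (h : x * y = x * z) : y = z := by
  rw [← inv_mul_mul x y, h, inv_mul_mul]

theorem right_cancel {x y z : Q} (h : y * x = z * x) : y = z := by
  rw [← mul_mul_inv x y, h, mul_mul_inv]

@[simp] theorem inv_inv' (x : Q) : x⁻¹⁻¹ = x := by
  apply left_cancel (x := x⁻¹); simp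

theorem mul_inv' (x y : Q) : (x * y)⁻¹ = y⁻¹ * x⁻¹ := by
  apply right_cancel (x := x)
  apply left_cancel (x := x * y)
  simp only [mul_inv_mul, mul_inv_mul_self, mul_mul_inv]

@[simp] theorem inv_one' : (1 : Q)⁻¹ = 1 := by simpa using inv_mul_self (1 : Q)

theorem sq_mul (x y : Q) : x * x * y = x * (x * y) := by simpa using c_law 1 x y

theorem mul_sq (x y : Q) : y * (x * x) = y * x * x := by simpa using (c_law y x 1).symm

/-- Right-nuclear elements. In a C loop they are nuclear. -/
def IsNuc (n : Q) : Prop := ∀ x y : Q, x * y * n = x * (y * n)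

theorem isNuc_one : IsNuc (1 : Q) := fun x y => by simp

theorem IsNuc.inv {n : Q} (h : IsNuc n) : IsNuc n⁻¹ := fun x y => by
  apply right_cancel (x := n)
  simpa using (h x (y * n⁻¹)).symm

theorem IsNuc.mul {m n : Q} (hm : IsNuc m) (hn : IsNuc n) : IsNuc (m * n) := fun x y => by
  rw [← hn, hm, hn, hn]

theorem isNuc_of_left {n : Q} (h : ∀ x y : Q, n * x * y = n * (x * y)) : IsNuc n := by
  have h1 : IsNuc n⁻¹ := fun x y => by
    have := congrArg (·⁻¹) (h y⁻¹ x⁻¹)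
    simpa [mul_inv'] using this.symm
  simpa using h1.inv

theorem IsNuc.left {n : Q} (h : IsNuc n) (x y : Q) : n * x * y = n * (x * y) := by
  have := congrArg (·⁻¹) (h.inv y⁻¹ x⁻¹)
  simpa [mul_inv'] using this.symm

theorem IsNuc.mid {n : Q} (h : IsNuc n) (x y : Q) : x * n * y = x * (n * y) := by
  have h1 := h (x * n) (n⁻¹ * x⁻¹)
  have h2 : ∀ w z : Q, w⁻¹ * z = w⁻¹ * n⁻¹ * (n * z) := fun w z => by
    apply left_cancel (x := n * w)
    have h3 := mul_inv_mul (n * w) (n * z)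
    rw [mul_inv'] at h3
    rw [h3, h.left, mul_inv_mul]
  have := h2 (x * n)⁻¹ y
  simpa using this

theorem isNuc_of_mid {n : Q} (h : ∀ x y : Q, x * n * y = x * (n * y)) : IsNuc n := by
  apply isNuc_of_left
  intro x y
  have h1 := h (n⁻¹ * x⁻¹)⁻¹⁻¹⁻¹ (x * y)
  have h2 : ∀ z, (x⁻¹ * n⁻¹) * (n * z) = x⁻¹ * z := fun z => by rw [← h]; simp
  have h3 := h2 (x * y)
  apply left_cancel (x := (n * x)⁻¹)
  rw [inv_mul_mul, mul_inv', h3, inv_mul_mul]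

theorem isNuc_sq (x : Q) : IsNuc (x * x) :=
  isNuc_of_mid fun a b => by rw [mul_sq, c_law, sq_mul]

/-- The map `u ↦ x⁻¹ * (u * x)`. -/
def cnj (x u : Q) : Q := x⁻¹ * (u * x)

@[simp] theorem mul_cnj (x u : Q) : x * cnj x u = u * x := by simp [cnj]

theorem IsNuc.mul_mul_inv_self {n : Q} (h : IsNuc n) (x : Q) : IsNuc (x * n * x⁻¹) := by
  have h1 : IsNuc (x * n * x) := by
    have := (isNuc_sq (x * n)).mul h.inv
    rw [← h (x * n) x] at this
    simpa using this
  have := h1.mul (isNuc_sq x⁻¹)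
  rw [mul_sq] at this
  simpa using this

theorem IsNuc.cnj {n : Q} (h : IsNuc n) (x : Q) : IsNuc (cnj x n) := by
  have := h.mul_mul_inv_self x⁻¹
  rw [inv_inv', h.mid] at this
  exact this

theorem exists_mul_eq {x y : Q} : ∃ n : Q, IsNuc n ∧ x * y = y * x * n := by
  have h1 : (y * x) * (CLoop.cnj x (y⁻¹ * y⁻¹) * (x⁻¹ * x⁻¹)) = y⁻¹ * x⁻¹ := by
    have hy := isNuc_sq y⁻¹
    rw [← isNuc_sq x⁻¹, hy.cnj x, mul_cnj, ← hy.mid, mul_sq, mul_sq]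
    simp
  refine ⟨CLoop.cnj x (y⁻¹ * y⁻¹) * (x⁻¹ * x⁻¹) * (x * y * (x * y)),
    (((isNuc_sq _).cnj x).mul (isNuc_sq _)).mul (isNuc_sq _), ?_⟩
  rw [← isNuc_sq (x * y), h1, ← mul_inv']
  simp

/-- Congruence modulo the nucleus. -/
def nucSetoid (Q : Type*) [CLoop Q] : Setoid Q where
  r x y := ∃ n, IsNuc n ∧ y = x * n
  iseqv :=
    { refl := fun x => ⟨1, isNuc_one, by simp⟩
      symm := by
        rintro x _ ⟨n, hn, rfl⟩
        exact ⟨n⁻¹, hn.inv, by simp⟩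
      trans := by
        rintro x _ _ ⟨n, hn, rfl⟩ ⟨m, hm, rfl⟩
        exact ⟨n * m, hn.mul hm, hm _ _⟩ }

theorem mul_mul_mul_nuc {n m : Q} (hn : IsNuc n) (hm : IsNuc m) (x y : Q) :
    x * n * (y * m) = x * y * (cnj y n * m) := by
  rw [← hm (x * n), hn.mid, ← mul_cnj y n, ← hn.cnj y, hm]

/-- The quotient by the nucleus. -/
def NucQuot (Q : Type*) [CLoop Q] : Type _ := Quotient (nucSetoid Q)

/-- The class of an element modulo the nucleus. -/
def cls (x : Q) : NucQuot Q := Quotient.mk (nucSetoid Q) x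

theorem cls_eq_cls {x y : Q} : cls x = cls y ↔ ∃ n, IsNuc n ∧ y = x * n := Quotient.eq

instance : SteinerLoop (NucQuot Q) where
  mul := Quotient.map₂ (· * ·) (by
    rintro x _ ⟨n, hn, rfl⟩ y _ ⟨m, hm, rfl⟩
    exact ⟨_, (hn.cnj y).mul hm, mul_mul_mul_nuc hn hm x y⟩)
  one := cls 1
  one_mul := by rintro ⟨x⟩; exact congrArg cls (one_mul x)
  mul_one := by rintro ⟨x⟩; exact congrArg cls (mul_one x)
  mul_comm := by
    rintro ⟨x⟩ ⟨y⟩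
    exact cls_eq_cls.2 exists_mul_eq
  mul_mul_self_left := by
    rintro ⟨x⟩ ⟨y⟩
    refine cls_eq_cls.2 ⟨(cnj y (x * x))⁻¹, ((isNuc_sq x).cnj y).inv, ?_⟩
    change y = x * (x * y) * _
    rw [← sq_mul, ← mul_cnj y (x * x), mul_mul_inv]

@[simp] theorem cls_mul (x y : Q) : cls (x * y) = cls x * cls y := rfl

@[simp] theorem cls_one : cls (1 : Q) = 1 := rfl

theorem isNuc_of_cls {n : Q} (h : cls n = 1) : IsNuc n := by
  obtain ⟨m, hm, rfl⟩ := cls_eq_cls.1 (h.symm : cls 1 = cls n)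
  simpa using hm

@[simp] theorem cls_inv (x : Q) : cls x⁻¹ = cls x := by
  have : cls x * cls x⁻¹ = 1 := by rw [← cls_mul]; simp
  simpa using SteinerLoop.eq_mul_of_mul_eq this

end CLoop

/-- A C loop with commuting inner mappings. -/
class AIMCLoop (Q : Type*) extends CLoop Q where
  cnj_comm : ∀ x y u : Q, CLoop.cnj x (CLoop.cnj y u) = CLoop.cnj y (CLoop.cnj x u)
  lam_comm : ∀ x y z w u : Q, (x * y)⁻¹ * (x * (y * ((z * w)⁻¹ * (z * (w * u))))) =
    (z * w)⁻¹ * (z * (w * ((x * y)⁻¹ * (x * (y * u)))))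
  cnj_lam : ∀ x y z u : Q, CLoop.cnj z ((x * y)⁻¹ * (x * (y * u))) =
    (x * y)⁻¹ * (x * (y * CLoop.cnj z u))

namespace AIMCLoop

open CLoop

variable {Q : Type*} [AIMCLoop Q] {φ ψ θ : Equiv.Perm Q}

instance : SteinerAIMLoop (NucQuot Q) where
  lam_comm := by
    rintro ⟨x⟩ ⟨y⟩ ⟨z⟩ ⟨w⟩ ⟨u⟩
    have := congrArg cls (lam_comm x y z w u)
    simp only [cls_mul, cls_inv] at this
    exact this

/-- Left translation by `x`. -/
def tr (x : Q) : Equiv.Perm Q where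
  toFun := (x * ·)
  invFun := (x⁻¹ * ·)
  left_inv := inv_mul_mul x
  right_inv := mul_inv_mul x

@[simp] theorem tr_apply (x y : Q) : tr x y = x * y := rfl

@[simp] theorem tr_inv_apply (x y : Q) : (tr x)⁻¹ y = x⁻¹ * y := rfl

theorem tr_inv (x : Q) : (tr x)⁻¹ = tr x⁻¹ := by ext; rfl

variable (Q) in
/-- The left multiplication group. -/
def mlt : Subgroup (Equiv.Perm Q) := Subgroup.closure (Set.range tr)

variable (Q) in
/-- The left inner mapping group. -/
def inn : Subgroup (Equiv.Perm Q) := mlt Q ⊓ MulAction.stabilizer (Equiv.Perm Q) (1 : Q)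

theorem tr_mem (x : Q) : tr x ∈ mlt Q := Subgroup.subset_closure ⟨x, rfl⟩

theorem map_one_of_mem (hφ : φ ∈ inn Q) : φ 1 = 1 := hφ.2

/-- The inner mapping `u ↦ (x * y)⁻¹ * (x * (y * u))`. -/
def lam (x y : Q) : Equiv.Perm Q := (tr (x * y))⁻¹ * tr x * tr y

@[simp] theorem lam_apply (x y u : Q) : lam x y u = (x * y)⁻¹ * (x * (y * u)) := rfl

theorem lam_mem (x y : Q) : lam x y ∈ inn Q :=
  ⟨(mlt Q).mul_mem ((mlt Q).mul_mem ((mlt Q).inv_mem (tr_mem _)) (tr_mem _)) (tr_mem _), by simp⟩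

theorem mlt_induction {p : ∀ g : Equiv.Perm Q, g ∈ mlt Q → Prop} (one : p 1 (one_mem _))
    (tr_mul : ∀ x g, (hg : g ∈ mlt Q) → p g hg → p (tr x * g) (mul_mem (tr_mem x) hg))
    {g : Equiv.Perm Q} (hg : g ∈ mlt Q) : p g hg := by
  induction hg using Subgroup.closure_induction_left with
  | one => exact one
  | mul_left _ hx g hg ih =>
    obtain ⟨x, rfl⟩ := hx
    exact tr_mul x g hg ih
  | inv_mul_cancel _ hx g hg ih =>
    obtain ⟨x, rfl⟩ := hx
    simpa only [← tr_inv] using tr_mul x⁻¹ g hg ih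

theorem inn_le_closure :
    inn Q ≤ Subgroup.closure (Set.range fun p : Q × Q => lam p.1 p.2) := by
  have hle : Subgroup.closure (Set.range fun p : Q × Q => lam p.1 p.2) ≤ inn Q := by
    rw [Subgroup.closure_le]
    rintro _ ⟨p, rfl⟩
    exact lam_mem _ _
  have key : ∀ g ∈ mlt Q, ∃ x : Q,
      ∃ h ∈ Subgroup.closure (Set.range fun p : Q × Q => lam p.1 p.2), g = tr x * h := by
    intro g hg
    induction hg using mlt_induction with
    | one => exact ⟨1, 1, one_mem _, by ext; simp⟩
    | tr_mul y g _ ih =>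
      obtain ⟨x, h, hh, rfl⟩ := ih
      refine ⟨y * x, lam y x * h, mul_mem (Subgroup.subset_closure ⟨(y, x), rfl⟩) hh, ?_⟩
      ext t; simp
  intro g hg
  obtain ⟨x, h, hh, rfl⟩ := key g hg.1
  have h1 : h 1 = 1 := (hle hh).2
  have hx : x = 1 := by simpa [h1] using hg.2
  have : tr (1 : Q) = 1 := by ext; simp
  rwa [hx, this, one_mul]

theorem inn_comm (hφ : φ ∈ inn Q) (hψ : ψ ∈ inn Q) (x : Q) : φ (ψ x) = ψ (φ x) := by
  have hc : ∀ a ∈ Set.range (fun p : Q × Q => lam p.1 p.2),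
      ∀ b ∈ Set.range (fun p : Q × Q => lam p.1 p.2), a * b = b * a := by
    rintro _ ⟨p, rfl⟩ _ ⟨q, rfl⟩
    ext u
    exact lam_comm _ _ _ _ _
  have := Subgroup.le_centralizer_iff_isMulCommutative.2 (Subgroup.isMulCommutative_closure hc)
  have h := Subgroup.mem_centralizer_iff.1 (this (inn_le_closure hφ)) ψ (inn_le_closure hψ)
  exact (congrArg (fun g : Equiv.Perm Q => g x) h).symm

theorem cnj_map (hφ : φ ∈ inn Q) (z u : Q) : cnj z (φ u) = φ (cnj z u) := by
  have h := inn_le_closure hφ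
  clear hφ
  induction h using Subgroup.closure_induction generalizing u with
  | mem g hg => obtain ⟨p, rfl⟩ := hg; exact cnj_lam _ _ _ _
  | one => rfl
  | mul g k _ _ ihg ihk => simp only [Equiv.Perm.mul_apply, ihg, ihk]
  | inv g _ ih => rw [Equiv.Perm.eq_inv_iff_eq, ← ih]; simp

theorem map_mul_nuc (hφ : φ ∈ mlt Q) {n : Q} (hn : IsNuc n) (x : Q) :
    φ (x * n) = φ x * n := by
  induction hφ using mlt_induction with
  | one => rfl
  | tr_mul y g _ ih => simp only [Equiv.Perm.mul_apply, ih, tr_apply, hn y (g x)]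

theorem map_nuc (hφ : φ ∈ inn Q) {n : Q} (hn : IsNuc n) : φ n = n := by
  simpa [map_one_of_mem hφ] using map_mul_nuc hφ.1 hn 1

theorem map_nuc_mul (hφ : φ ∈ inn Q) {n : Q} (hn : IsNuc n) (x : Q) :
    φ (n * x) = n * φ x := by
  have key : ∀ g ∈ mlt Q, ∃ m : Q, ∀ x, g (n * x) = m * g x ∧ IsNuc m := by
    intro g hg
    induction hg using mlt_induction with
    | one => exact ⟨n, fun x => ⟨rfl, hn⟩⟩
    | tr_mul y g _ ih =>
      obtain ⟨m, hm⟩ := ih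
      have hm' := (hm 1).2
      refine ⟨y * m * y⁻¹, fun x => ⟨?_, hm'.mul_mul_inv_self y⟩⟩
      simp only [Equiv.Perm.mul_apply, tr_apply]
      rw [(hm x).1, ← (hm'.mul_mul_inv_self y).left, mul_inv_mul_self, hm'.mid]
  obtain ⟨m, hm⟩ := key φ hφ.1
  have h1 := (hm 1).1
  rw [mul_one, map_nuc hφ hn, map_one_of_mem hφ, mul_one] at h1
  rw [(hm x).1, ← h1]

theorem cnj_mul {n : Q} (hn : IsNuc n) (x y : Q) : cnj (x * y) n = cnj y (cnj x n) := by
  apply left_cancel (x := x * y)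
  rw [mul_cnj, (hn.cnj x).cnj y, mul_cnj, ← (hn.cnj x).mid, mul_cnj, hn.left]

theorem cnj_cnj_inv {n : Q} (hn : IsNuc n) (x : Q) : cnj x (cnj x⁻¹ n) = n := by
  rw [← cnj_mul hn]; simp [cnj]

/-- Central elements of a C loop. -/
def IsCen (f : Q) : Prop := IsNuc f ∧ ∀ x : Q, f * x = x * f

theorem commutator_comm {x y c n : Q} (h : x * y = y * x * c) (hn : IsNuc n) :
    n * c = c * n := by
  have h1 : ∀ m : Q, IsNuc m → cnj c m = m := by
    intro m hm
    have h2 : ∀ k, IsNuc k → cnj c (cnj x (cnj y k)) = cnj x (cnj y k) := fun k hk => by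
      rw [← cnj_mul hk y x, ← cnj_mul hk (y * x) c, ← h, cnj_mul hk, cnj_mul hk, cnj_comm]
    have h3 := h2 _ ((hm.cnj x⁻¹).cnj y⁻¹)
    rwa [cnj_cnj_inv (hm.cnj _), cnj_cnj_inv hm] at h3
  rw [← mul_cnj, h1 n hn]

theorem isCen_of_map {y f : Q} (hφ : φ ∈ inn Q) (h : φ y = y * f) (hf : IsNuc f) : IsCen f := by
  refine ⟨hf, fun z => ?_⟩
  obtain ⟨c, hc, e⟩ := exists_mul_eq (x := y) (y := z)
  have h1 := cnj_map hφ z y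
  have h2 : cnj z y = y * c := by rw [cnj, e, hc, inv_mul_mul]
  rw [h2, map_mul_nuc hφ.1 hc, h] at h1
  have h3 : cnj z (y * f) = y * c * cnj z f := by
    apply left_cancel (x := z)
    rw [mul_cnj, hf.mid, ← mul_cnj z f, ← (hf.cnj z), e, ← (hf.cnj z), hc]
  rw [h3, (hf.cnj z) y c, hc y f, ← commutator_comm e (hf.cnj z)] at h1
  rw [← mul_cnj z f, right_cancel (left_cancel h1)]

theorem exists_descent (hφ : φ ∈ inn Q) :
    ∃ g ∈ SteinerLoop.inn (NucQuot Q), ∀ x, cls (φ x) = g (cls x) := by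
  have key : ∀ φ ∈ mlt Q, ∃ g ∈ SteinerLoop.mlt (NucQuot Q), ∀ x, cls (φ x) = g (cls x) := by
    intro φ hφ
    induction hφ using mlt_induction with
    | one => exact ⟨1, one_mem _, fun x => rfl⟩
    | tr_mul y k _ ih =>
      obtain ⟨g, hg, h⟩ := ih
      exact ⟨SteinerLoop.tr (cls y) * g, mul_mem (SteinerLoop.tr_mem _) hg, fun x => by simp [h]⟩
  obtain ⟨g, hg, h⟩ := key φ hφ.1
  have h1 := h 1
  rw [map_one_of_mem hφ] at h1
  exact ⟨g, ⟨hg, h1.symm⟩, h⟩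

/-- The deviation of `φ` from fixing `x`. -/
def dev (φ : Equiv.Perm Q) (x : Q) : Q := x⁻¹ * φ x

@[simp] theorem mul_dev (φ : Equiv.Perm Q) (x : Q) : x * dev φ x = φ x := mul_inv_mul _ _

@[simp] theorem cls_dev (φ : Equiv.Perm Q) (x : Q) : cls (dev φ x) = cls x * cls (φ x) := by
  simp [dev]

/-- If `θ` fixes `u` modulo the nucleus, it commutes with translation by `dev φ u`. -/
theorem map_dev_mul (hθ : θ ∈ inn Q) (hφ : φ ∈ inn Q) {u : Q} (hu : cls (θ u) = cls u) (t : Q) :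
    θ (dev φ u * t) = dev φ u * θ t := by
  obtain ⟨f, hf, e⟩ := cls_eq_cls.1 hu.symm
  have hM : tr f⁻¹ * tr u⁻¹ * θ * tr u ∈ inn Q :=
    ⟨mul_mem (mul_mem (mul_mem (tr_mem _) (tr_mem _)) hθ.1) (tr_mem _), by simp [e]⟩
  have hA : ∀ t, θ (u * φ t) = u * φ (u⁻¹ * θ (u * t)) := fun t => by
    have := inn_comm hM hφ t
    simp only [Equiv.Perm.mul_apply, tr_apply] at this
    rw [map_nuc_mul hφ hf.inv] at this
    rw [← left_cancel this, mul_inv_mul]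
  have hN : tr (u * φ u⁻¹)⁻¹ * tr u * φ * tr u⁻¹ ∈ inn Q :=
    ⟨mul_mem (mul_mem (mul_mem (tr_mem _) (tr_mem _)) hφ.1) (tr_mem _), by simp⟩
  have hm := isNuc_sq u
  have hd : dev φ u = (u * u)⁻¹ * (u * φ u⁻¹ * (u * u)) := by
    apply left_cancel (x := u * u)
    rw [mul_inv_mul, hm, ← map_mul_nuc hφ.1 hm, inv_mul_mul, sq_mul, mul_dev]
  generalize u * φ u⁻¹ = p at *
  have hB : ∀ s, θ (p * s) = p * θ s := fun s => by
    have h := inn_comm hN hθ (u * φ.symm (u⁻¹ * (p * s)))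
    simp only [Equiv.Perm.mul_apply, tr_apply, inv_mul_mul, Equiv.apply_symm_apply,
      mul_inv_mul] at h
    have h2 := hA (φ.symm (u⁻¹ * (p * s)))
    rw [Equiv.apply_symm_apply, mul_inv_mul] at h2
    rw [← h2] at h
    rw [← h, mul_inv_mul]
  rw [hd, hm.inv.left, hm.mid, map_nuc_mul hθ hm.inv, hB, map_nuc_mul hθ hm, hm.inv.left, hm.mid]

theorem map_dev_of_cls (hθ : θ ∈ inn Q) (hφ : φ ∈ inn Q) {u : Q} (hu : cls (θ u) = cls u) :
    θ (dev φ u) = dev φ u := by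
  simpa [map_one_of_mem hθ] using map_dev_mul hθ hφ hu 1

/-- The class of `c` modulo the nucleus is fixed by all inner mappings of the quotient. -/
def QuotCen (c : Q) : Prop := ∀ g ∈ SteinerLoop.inn (NucQuot Q), g (cls c) = cls c

theorem quotCen_dev (hφ : φ ∈ inn Q) (x : Q) : QuotCen (dev φ x) := by
  obtain ⟨g, hg, h⟩ := exists_descent hφ
  intro k hk
  rw [cls_dev, h, SteinerAIMLoop.map_dev hk hg]

theorem QuotCen.cls_map {c : Q} (hc : QuotCen c) (hθ : θ ∈ inn Q) : cls (θ c) = cls c := by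
  obtain ⟨g, hg, h⟩ := exists_descent hθ
  rw [h, hc g hg]

theorem isCen_dev (hθ : θ ∈ inn Q) {c : Q} (h : cls (θ c) = cls c) : IsCen (dev θ c) := by
  refine isCen_of_map hθ (mul_dev θ c).symm (isNuc_of_cls ?_)
  rw [cls_dev, h, SteinerLoop.mul_self]

theorem dev_mul_nuc (hθ : θ ∈ inn Q) {c : Q} (h : cls (θ c) = cls c) {n : Q} (hn : IsNuc n) :
    dev θ (c * n) = dev θ c := by
  have hf := isCen_dev hθ h
  apply left_cancel (x := c * n)
  rw [mul_dev, map_mul_nuc hθ.1 hn, ← mul_dev θ c, hf.1, hn, hf.2]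

theorem dev_congr (hθ : θ ∈ inn Q) {a b : Q} (h : cls (θ a) = cls a) (hab : cls a = cls b) :
    dev θ a = dev θ b := by
  obtain ⟨n, hn, rfl⟩ := cls_eq_cls.1 hab
  rw [dev_mul_nuc hθ h hn]

/-- The deviation of `θ` from fixing products with left factor `x`. -/
def chi (θ : Equiv.Perm Q) (x : Q) : Equiv.Perm Q := tr (θ x)⁻¹ * θ * tr x * θ⁻¹

theorem chi_apply (θ : Equiv.Perm Q) (x t : Q) : chi θ x t = (θ x)⁻¹ * θ (x * θ⁻¹ t) := rfl

theorem chi_mem (hθ : θ ∈ inn Q) (x : Q) : chi θ x ∈ inn Q := by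
  refine ⟨mul_mem (mul_mem (mul_mem (tr_mem _) hθ.1) (tr_mem _)) ((mlt Q).inv_mem hθ.1), ?_⟩
  change chi θ x 1 = 1
  rw [chi_apply, map_one_of_mem (inv_mem hθ), mul_one, inv_mul_self]

theorem map_mul (θ : Equiv.Perm Q) (x t : Q) : θ (x * t) = θ x * chi θ x (θ t) := by
  rw [chi_apply, mul_inv_mul, show θ⁻¹ (θ t) = t from θ.symm_apply_apply t]

theorem cls_chi (hθ : θ ∈ inn Q) : ∃ g ∈ SteinerLoop.inn (NucQuot Q),
    (∀ x, cls (θ x) = g (cls x)) ∧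
    ∀ x t, cls (chi θ x t) = SteinerAIMLoop.chi g (cls x) (cls t) := by
  obtain ⟨g, hg, h⟩ := exists_descent hθ
  refine ⟨g, hg, h, fun x t => ?_⟩
  have h1 : cls (θ⁻¹ t) = g (cls t) := by
    rw [← SteinerAIMLoop.inn_inn hg (cls (θ⁻¹ t)), ← h,
      show θ (θ⁻¹ t) = t from θ.apply_symm_apply t]
  rw [chi_apply, SteinerAIMLoop.chi_apply, cls_mul, cls_inv, h, h, cls_mul, h1]

theorem cls_chi_self (hθ : θ ∈ inn Q) (x : Q) : cls (chi θ x x) = cls x := by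
  obtain ⟨g, hg, -, h⟩ := cls_chi hθ
  rw [h, SteinerAIMLoop.chi_apply_self hg]

theorem QuotCen.cls_chi {c : Q} (hc : QuotCen c) (hθ : θ ∈ inn Q) (t : Q) :
    cls (chi θ c t) = cls t := by
  obtain ⟨g, hg, -, h⟩ := AIMCLoop.cls_chi hθ
  rw [h, SteinerAIMLoop.chi_eq_of_fixed hc hg]

theorem dev_one_iff {a : Q} : dev θ a = 1 ↔ θ a = a := by
  constructor
  · intro h; rw [← mul_dev θ a, h, mul_one]
  · intro h; rw [dev, h, inv_mul_self]

theorem dev_dev_eq_one (hθ : θ ∈ inn Q) (hφ : φ ∈ inn Q) {u : Q} (hu : cls (θ u) = cls u) :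
    dev θ (dev φ u) = 1 :=
  dev_one_iff.2 (map_dev_of_cls hθ hφ hu)

/-- Elements of the preimage of the quotient's centre that are fixed by all inner mappings
acting trivially modulo the nucleus. -/
def Good (a : Q) : Prop :=
  QuotCen a ∧ ∀ θ ∈ inn Q, (∀ x, cls (θ x) = cls x) → θ a = a

theorem good_dev (hφ : φ ∈ inn Q) (x : Q) : Good (dev φ x) :=
  ⟨quotCen_dev hφ x, fun _ hθ h => map_dev_of_cls hθ hφ (h x)⟩

theorem QuotCen.mul {a b : Q} (ha : QuotCen a) (hb : QuotCen b) : QuotCen (a * b) := by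
  intro g hg
  rw [cls_mul, SteinerAIMLoop.map_mul_of_fixed ha hg, hb g hg]

theorem dev_mul (hθ : θ ∈ inn Q) {a b : Q} (ha : QuotCen a) (hb : Good b) :
    dev θ (a * b) = dev θ a * dev θ b := by
  have hf := isCen_dev hθ (ha.cls_map hθ)
  have hg := isCen_dev hθ (hb.1.cls_map hθ)
  have h1 : chi θ a (b * dev θ b) = b * dev θ b := by
    rw [map_mul_nuc (chi_mem hθ a).1 hg.1, hb.2 _ (chi_mem hθ a) (ha.cls_chi hθ)]
  apply left_cancel (x := a * b)
  rw [mul_dev, map_mul, ← mul_dev θ b, h1, ← mul_dev θ a, hf.1.mid, hf.2 (b * dev θ b),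
    hf.2 (dev θ b), ← hf.1 a, ← hf.1 (a * b), ← hg.1 a]

theorem Good.mul {a b : Q} (ha : Good a) (hb : Good b) : Good (a * b) := by
  refine ⟨ha.1.mul hb.1, fun θ hθ h => ?_⟩
  rw [map_mul, ha.2 θ hθ h, hb.2 θ hθ h, hb.2 _ (chi_mem hθ a) (ha.1.cls_chi hθ)]

theorem mul_mul_dev (hφ : φ ∈ inn Q) (x t : Q) : t * x * dev φ x = t * (x * dev φ x) := by
  have h := map_dev_of_cls (lam_mem t x) hφ (u := x) (by simp)
  rw [lam_apply] at h
  rw [← mul_inv_mul (t * x) (t * (x * dev φ x)), h]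

theorem mul_mul_dev' (hφ : φ ∈ inn Q) (x t : Q) : x * t * dev φ x = x * (t * dev φ x) := by
  have h := map_dev_of_cls (lam_mem x t) hφ (u := x) (by simp)
  rw [lam_apply] at h
  rw [← mul_inv_mul (x * t) (x * (t * dev φ x)), h]

theorem mul_dev_mul (hφ : φ ∈ inn Q) (x t : Q) : x * dev φ x * t = x * (dev φ x * t) := by
  have h := congrArg (·⁻¹) (mul_mul_dev hφ x (x * (dev φ x * t))⁻¹)
  simp only [mul_inv', inv_inv'] at h
  rw [← mul_inv', inv_mul_mul, inv_mul_mul] at h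
  conv_lhs => rw [h, mul_inv_mul]

theorem dev_mul_self (hφ : φ ∈ inn Q) (x : Q) : dev φ x * x = x * dev φ x := by
  have h := cnj_map hφ x x
  rw [show cnj x x = x from inv_mul_mul x x, ← mul_dev φ x, cnj, mul_dev_mul hφ, inv_mul_mul] at h
  exact h

theorem dev_mul_dev (hθ : θ ∈ inn Q) (hφ : φ ∈ inn Q) (x : Q) :
    dev θ x * dev φ x = dev φ x * dev θ x := by
  have h := cnj_map hφ (dev θ x) x
  have h1 : cnj (dev θ x) x = x := by rw [cnj, ← dev_mul_self hθ, inv_mul_mul]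
  have h2 := mul_cnj (dev θ x) (φ x)
  rw [h, h1, ← mul_dev φ x, mul_dev_mul hφ, ← mul_mul_dev hφ, dev_mul_self hθ,
    mul_mul_dev' hφ] at h2
  exact left_cancel h2

/-- The operations `dev θ` and `dev φ` commute. -/
theorem dev_dev_comm (hθ : θ ∈ inn Q) (hφ : φ ∈ inn Q) (x : Q) :
    dev θ (dev φ x) = dev φ (dev θ x) := by
  have key : ∀ θ φ : Equiv.Perm Q, θ ∈ inn Q → φ ∈ inn Q →
      θ (φ x) = x * (dev θ x * dev φ x) * dev θ (dev φ x) := by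
    intro θ φ hθ hφ
    have hf := (isCen_dev hθ ((quotCen_dev hφ x).cls_map hθ)).1
    rw [← mul_dev φ x, map_mul, ← mul_dev θ (dev φ x), map_mul_nuc (chi_mem hθ x).1 hf,
      map_dev_of_cls (chi_mem hθ x) hφ (cls_chi_self hθ x), ← hf, ← mul_dev θ x,
      mul_dev_mul hθ]
  have h1 := key θ φ hθ hφ
  rw [inn_comm hθ hφ, key φ θ hφ hθ, dev_mul_dev hφ hθ] at h1
  exact (left_cancel h1).symm

theorem cls_dev_lam (u v w : Q) :
    cls (dev (lam u v) w) = SteinerAIMLoop.asc (cls u) (cls v) (cls w) := by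
  rw [SteinerAIMLoop.asc_eq]
  simp

theorem dev_dev_lam_mul (hψ : ψ ∈ inn Q) (c d x : Q) :
    dev ψ (dev (lam c d) (c * x)) = dev ψ (dev (lam c d) x) := by
  have hβ := lam_mem c d
  have hχ := chi_mem hψ c
  have hc : cls (lam c d c) = cls c := by simp
  have h1 : cls (dev ψ (c * x)) =
      cls (dev ψ c * (dev (chi ψ c) (ψ x) * dev ψ x)) := by
    obtain ⟨k, hk, e, e'⟩ := cls_chi hψ
    simp only [cls_dev, cls_mul, e, e', SteinerAIMLoop.mul_map_mul_eq hk]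
  have h2 : dev (lam c d) (dev (chi ψ c) (ψ x)) = 1 := by
    rw [dev_dev_comm hβ hχ, dev_congr hχ (b := dev (lam (ψ x) d) c)
      ((quotCen_dev hβ _).cls_map hχ)
      (by rw [cls_dev_lam, cls_dev_lam, SteinerAIMLoop.asc_comm]),
      dev_dev_eq_one hχ (lam_mem _ _) (cls_chi_self hψ c)]
  rw [dev_dev_comm hψ hβ, dev_congr hβ ((quotCen_dev hψ _).cls_map hβ) h1,
    dev_mul hβ (quotCen_dev hψ c) ((good_dev hχ _).mul (good_dev hψ x)),
    dev_mul hβ (quotCen_dev hχ _) (good_dev hψ x), dev_dev_eq_one hβ hψ hc, h2, one_mul, one_mul,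
    dev_dev_comm hβ hψ]

theorem map_dev_lam (hψ : ψ ∈ inn Q) (u v w : Q) :
    ψ (dev (lam u v) w) = dev (lam u v) w := by
  have hq : ∀ x y z : Q, Good (dev (lam x y) z) := fun x y z => good_dev (lam_mem x y) z
  have h1 : cls (dev (lam u v) w) = cls (dev (lam (u * w) v) u * dev (lam (u * w) v) w) := by
    rw [cls_mul, cls_dev_lam, cls_dev_lam, cls_dev_lam, cls_mul, SteinerAIMLoop.asc_eq_mul_asc]
  have h2 : dev ψ (dev (lam (u * w) v) w) = dev ψ (dev (lam (u * w) v) u) := by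
    rw [← dev_dev_lam_mul hψ (u * w) v u]
    exact dev_congr hψ ((hq _ _ _).1.cls_map hψ) (by simp)
  have he := hq (u * w) v u
  rw [← dev_one_iff, dev_congr hψ ((hq _ _ _).1.cls_map hψ) h1, dev_mul hψ he.1 (hq _ _ _), h2,
    ← dev_mul hψ he.1 he, dev_one_iff, map_nuc hψ (isNuc_sq _)]

theorem isCen_dev_lam (u v w : Q) : IsCen (dev (lam u v) w) := by
  refine isCen_of_map (lam_mem u v) (mul_dev _ w).symm fun x y => ?_
  have h := map_dev_lam (lam_mem x y) u v w
  rw [lam_apply] at h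
  rw [← mul_inv_mul (x * y) (x * (y * _)), h]

theorem IsCen.inv {f : Q} (hf : IsCen f) : IsCen f⁻¹ :=
  ⟨hf.1.inv, fun x => left_cancel (x := f) <| by
    rw [mul_inv_mul, ← hf.1.left, hf.2, mul_mul_inv]⟩

theorem isCen_associator (x y z : Q) : IsCen ((x * (y * z))⁻¹ * (x * y * z)) := by
  have hf := isCen_dev_lam x y z
  have h : x * (y * z) = x * y * z * dev (lam x y) z := by
    rw [hf.1, mul_dev, lam_apply, mul_inv_mul]
  rw [h, mul_inv', hf.1.inv.left, inv_mul_self, mul_one]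
  exact hf.inv

theorem isNuc_commutator (x y : Q) : IsNuc ((y * x)⁻¹ * (x * y)) := by
  obtain ⟨n, hn, h⟩ := exists_mul_eq (x := x) (y := y)
  rwa [h, inv_mul_mul]

end AIMCLoop

namespace LoopStr

variable {Q : Type*}

theorem ld_eq_of_mul_eq (L : LoopStr Q) {x y z : Q} (h : L.mul x y = z) : L.ld x z = y := by
  rw [← h, L.ld_mul]

theorem rd_one_mul_mul (L : LoopStr Q)
    (hC : ∀ x y z, L.mul (L.mul (L.mul x y) y) z = L.mul x (L.mul y (L.mul y z))) (x y : Q) :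
    L.mul (L.rd L.one x) (L.mul x y) = y := by
  have h := hC (L.rd L.one x) x (L.ld x y)
  rw [L.mul_rd, L.one_mul, L.mul_ld] at h
  exact h.symm

theorem rd_one_eq_ld_one (L : LoopStr Q)
    (hC : ∀ x y z, L.mul (L.mul (L.mul x y) y) z = L.mul x (L.mul y (L.mul y z))) (x : Q) :
    L.rd L.one x = L.ld x L.one := by
  have h := L.rd_one_mul_mul hC x (L.ld x L.one)
  rwa [L.mul_ld, L.mul_one] at h

/-- A loop satisfying the C law, as a `CLoop`. -/
abbrev toCLoop (L : LoopStr Q)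
    (hC : ∀ x y z, L.mul (L.mul (L.mul x y) y) z = L.mul x (L.mul y (L.mul y z))) : CLoop Q where
  mul := L.mul
  one := L.one
  inv x := L.ld x L.one
  one_mul := L.one_mul
  mul_one := L.mul_one
  inv_mul_mul x y := by
    change L.mul (L.ld x L.one) (L.mul x y) = y
    rw [← L.rd_one_eq_ld_one hC, L.rd_one_mul_mul hC]
  mul_inv_mul x y := by
    change L.mul x (L.mul (L.ld x L.one) y) = y
    rw [← L.rd_one_eq_ld_one hC]
    nth_rw 1 [← L.mul_ld x y]
    rw [L.rd_one_mul_mul hC, L.mul_ld]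
  mul_mul_inv x y := by
    change L.mul (L.mul y x) (L.ld x L.one) = y
    have h := hC (L.rd y x) x (L.ld x L.one)
    rwa [L.mul_ld, L.mul_one, L.mul_rd] at h
  mul_inv_mul_self x y := by
    change L.mul (L.mul y (L.ld x L.one)) x = y
    have h := hC (L.rd y (L.ld x L.one)) (L.ld x L.one) x
    rwa [← L.rd_one_eq_ld_one hC, L.mul_rd, L.mul_rd, L.mul_one, L.mul_rd,
      L.rd_one_eq_ld_one hC] at h
  c_law := hC

/-- An AIM loop satisfying the C law, as an `AIMCLoop`. -/
abbrev toAIMCLoop (L : LoopStr Q)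
    (hC : ∀ x y z, L.mul (L.mul (L.mul x y) y) z = L.mul x (L.mul y (L.mul y z)))
    (hAIM : L.IsAIM) : AIMCLoop Q :=
  letI := L.toCLoop hC
  have hld : ∀ x y : Q, L.ld x y = x⁻¹ * y := fun x y =>
    L.ld_eq_of_mul_eq (CLoop.mul_inv_mul x y)
  have hT : ∀ u x : Q, L.Tm u x = CLoop.cnj x u := fun u x => hld _ _
  have hL : ∀ u x y : Q, L.Lm u x y = (y * x)⁻¹ * (y * (x * u)) := fun u x y => hld _ _
  { cnj_comm := fun x y u => by simpa only [hT] using hAIM.1 u y x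
    lam_comm := fun x y z w u => by simpa only [hL] using hAIM.2.1 u w z y x
    cnj_lam := fun x y z u => by simpa only [hL, hT] using hAIM.2.2.2.1 u y x z }

theorem assoc_eq_one (L : LoopStr Q) {a : Q} (h : L.inNucleus a) (x y : Q) :
    L.assoc a x y = L.one ∧ L.assoc x a y = L.one ∧ L.assoc x y a = L.one := by
  simp only [assoc, h.1, h.2.1, h.2.2]
  exact ⟨L.ld_eq_of_mul_eq (L.mul_one _), L.ld_eq_of_mul_eq (L.mul_one _),
    L.ld_eq_of_mul_eq (L.mul_one _)⟩

end LoopStr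

/-- In an AIM C loop, associators and commutators lie in the nucleus,
and associators lie in the commutant. -/
theorem aim_c_loop_main {Q : Type*} (L : LoopStr Q)
    (hC : ∀ x y z,
      L.mul (L.mul (L.mul x y) y) z = L.mul x (L.mul y (L.mul y z)))
    (hAIM : L.IsAIM) :
    (∀ x y z u v,
      L.assoc (L.assoc x y z) u v = L.one ∧
      L.assoc u (L.assoc x y z) v = L.one ∧
      L.assoc u v (L.assoc x y z) = L.one) ∧
    (∀ x y z u,
      L.assoc (L.comm x y) z u = L.one ∧
      L.assoc z (L.comm x y) u = L.one ∧
      L.assoc z u (L.comm x y) = L.one) ∧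
    (∀ x y z u, L.comm (L.assoc x y z) u = L.one) := by
  let _ := L.toAIMCLoop hC hAIM
  have hld : ∀ x y : Q, L.ld x y = x⁻¹ * y := fun x y =>
    L.ld_eq_of_mul_eq (CLoop.mul_inv_mul x y)
  have hnuc : ∀ a : Q, CLoop.IsNuc a → L.inNucleus a := fun a ha => ⟨ha.left, ha.mid, ha⟩
  have hassoc : ∀ x y z : Q, AIMCLoop.IsCen (L.assoc x y z) := fun x y z => by
    rw [LoopStr.assoc, hld]
    exact AIMCLoop.isCen_associator x y z
  have hcomm : ∀ x y : Q, CLoop.IsNuc (L.comm x y) := fun x y => by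
    rw [LoopStr.comm, hld]
    exact AIMCLoop.isNuc_commutator x y
  refine ⟨fun x y z u v => L.assoc_eq_one (hnuc _ (hassoc x y z).1) u v,
    fun x y z u => L.assoc_eq_one (hnuc _ (hcomm x y)) z u, fun x y z u => ?_⟩
  exact L.ld_eq_of_mul_eq ((L.mul_one _).trans ((hassoc x y z).2 u).symm)
end
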